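/- Under Assumptions (A1)–(A3), for every r > 0 and every finite rooted graph (H,h): P( F^{𝔾_n}_{U_n}(r) is rooted-isomorphic to (H,h) ) → P( F_r is rooted-isomorphic to (H,h) ) as n → ∞, where U_n is a uniformly chosen vertex of 𝔾_n independent of everything else. -/

import Mathlib

open MeasureTheory ProbabilityTheory Filter Topology
open scoped ENNReal NNReal

noncomputable section

/-- Euclidean space `ℝ^d`. -/
abbrev Euc (d : ℕ) : Type := EuclideanSpace ℝ (Fin d)

open Classical in
/-- Real-valued indicator of a proposition. -/
noncomputable def indic (p : Prop) : ℝ := if p then 1 else 0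

/-- The box `I_n = [-n^{1/d}/2, n^{1/d}/2]^d`. -/
def boxIn (d n : ℕ) : Set (Euc d) :=
  {x | ∀ i, |x i| ≤ ((n : ℝ) ^ ((1 : ℝ) / d)) / 2}

/-- Uniform probability measure on the box `I_n` (which has Lebesgue measure `n`). -/
noncomputable def unifBox (d n : ℕ) : Measure (Euc d) :=
  (n : ℝ≥0∞)⁻¹ • (volume.restrict (boxIn d n))

/-- Uniform probability measure on `[0,1]`. -/
noncomputable def unif01 : Measure ℝ := volume.restrict (Set.Icc 0 1)

/-- Uniform probability measure on the open Euclidean ball of radius `r` about the origin. -/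
noncomputable def unifBall (d : ℕ) (r : ℝ) : Measure (Euc d) :=
  (volume (Metric.ball (0 : Euc d) r))⁻¹ • (volume.restrict (Metric.ball (0 : Euc d) r))

/-- The sequence of finite spatial inhomogeneous random graphs (SIRGs), on a probability
space `(Ω, P)`: for each `n`, vertex locations `Y n` are i.i.d. uniform on the box `I_n`
(these are the blown-up locations `Y_i = n^{1/d} X_i` with `X_i` i.i.d. uniform on the unit
cube), `Wt n` is a random weight vector, `U n` is an array whose entries for `i < j` are
i.i.d. Uniform[0,1] variables, the three being mutually independent; `κn n` is a connection
function with values in `[0,1]` (for positive first argument), measurable and symmetric in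
its last two arguments; `R n` is a pair of independent uniformly chosen vertices,
independent of everything else. -/
structure SIRGModel (d : ℕ) (Ω : Type) [MeasurableSpace Ω] where
  P : Measure Ω
  probP : IsProbabilityMeasure P
  Y : (n : ℕ) → Fin n → Ω → Euc d
  Wt : (n : ℕ) → Fin n → Ω → ℝ
  U : (n : ℕ) → Fin n → Fin n → Ω → ℝ
  R : (n : ℕ) → 0 < n → Fin 2 → Ω → Fin n
  κn : ℕ → ℝ → ℝ → ℝ → ℝ
  Y_meas : ∀ n i, Measurable (Y n i)
  Wt_meas : ∀ n i, Measurable (Wt n i)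
  U_meas : ∀ n i j, Measurable (U n i j)
  R_meas : ∀ n hn k, Measurable (R n hn k)
  κn_meas : ∀ n, Measurable (fun p : ℝ × ℝ × ℝ => κn n p.1 p.2.1 p.2.2)
  κn_nonneg : ∀ n t x y, 0 < t → 0 ≤ κn n t x y
  κn_le_one : ∀ n t x y, 0 < t → κn n t x y ≤ 1
  κn_symm : ∀ n t x y, κn n t x y = κn n t y x
  joint_law : ∀ n : ℕ,
      Measure.map (fun ω =>
        ((fun i => Y n i ω), (fun i => Wt n i ω),
          (fun p : {p : Fin n × Fin n // p.1 < p.2} => U n p.1.1 p.1.2 ω))) P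
        = (Measure.pi fun _ : Fin n => unifBox d n).prod
            ((Measure.map (fun ω i => Wt n i ω) P).prod
              (Measure.pi fun _ : {p : Fin n × Fin n // p.1 < p.2} => unif01))
  R_unif : ∀ n hn (i j : Fin n),
      P {ω | R n hn 0 ω = i ∧ R n hn 1 ω = j} = ((n : ℝ≥0∞) * n)⁻¹
  R_indep : ∀ n hn,
      IndepFun (fun ω => (R n hn 0 ω, R n hn 1 ω))
        (fun ω => ((fun i => Y n i ω), (fun i => Wt n i ω), (fun i j => U n i j ω))) P

variable {d : ℕ} {Ω : Type} [MeasurableSpace Ω]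

instance (M : SIRGModel d Ω) : IsProbabilityMeasure M.P := M.probP

/-- The random graph `𝔾_n`: for `i < j`, the edge `{i,j}` is present iff
`U_{ij} ≤ κ_n(‖Y_i - Y_j‖, W_i, W_j)`. -/
def SIRGModel.graph (M : SIRGModel d Ω) (n : ℕ) (ω : Ω) : SimpleGraph (Fin n) :=
  SimpleGraph.fromRel (fun i j =>
    i < j ∧ M.U n i j ω ≤
      M.κn n (dist (M.Y n i ω) (M.Y n j ω)) (M.Wt n i ω) (M.Wt n j ω))

open Classical in
/-- Degree of a vertex in a finite simple graph. -/
noncomputable def degOf {V : Type*} [Fintype V] (G : SimpleGraph V) (v : V) : ℕ :=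
  (Finset.univ.filter fun u => G.Adj v u).card

/-- Rooted isomorphism of rooted graphs. -/
def RootedIso {V₁ : Type*} {V₂ : Type*} (G₁ : SimpleGraph V₁) (r₁ : V₁)
    (G₂ : SimpleGraph V₂) (r₂ : V₂) : Prop :=
  ∃ φ : G₁ ≃g G₂, φ r₁ = r₂

/-- The (vertex set of the) ball of radius `K` around `o` in the graph `G`:
all vertices reachable from `o` within graph distance `K`. -/
def graphBall {V : Type*} (G : SimpleGraph V) (o : V) (K : ℕ) : Set V :=
  {v | G.Reachable o v ∧ G.dist o v ≤ K}

/-- `ballIso G o K H h`: the subgraph of `G` induced by the `K`-ball around `o`, rooted at `o`,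
is rooted-isomorphic to `(H, h)`. -/
def ballIso {V : Type*} (G : SimpleGraph V) (o : V) (K : ℕ)
    {V' : Type*} (H : SimpleGraph V') (h : V') : Prop :=
  ∃ ho : o ∈ graphBall G o K, RootedIso (G.induce (graphBall G o K)) ⟨o, ho⟩ H h

/-- The set of vertices whose location lies within Euclidean distance `r` of the location
of vertex `i`. -/
def SIRGModel.euclSet (M : SIRGModel d Ω) (n : ℕ) (ω : Ω) (i : Fin n) (r : ℝ) :
    Set (Fin n) :=
  {j | dist (M.Y n j ω) (M.Y n i ω) < r}

/-- The Euclidean graph neighbourhood `F^{𝔾_n}_i(r)`: the subgraph of `𝔾_n` induced by the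
vertices whose location is within distance `r` of the location of `i`. -/
def SIRGModel.euclNbhd (M : SIRGModel d Ω) (n : ℕ) (ω : Ω) (i : Fin n) (r : ℝ) :=
  (M.graph n ω).induce (M.euclSet n ω i r)

/-- `F^{𝔾_n}_i(r)`, rooted at `i`, is rooted-isomorphic to `(H, h)`. -/
def SIRGModel.euclNbhdIso (M : SIRGModel d Ω) (n : ℕ) (ω : Ω) (i : Fin n) (r : ℝ)
    {V : Type*} (H : SimpleGraph V) (h : V) : Prop :=
  ∃ hi : i ∈ M.euclSet n ω i r, RootedIso (M.euclNbhd n ω i r) ⟨i, hi⟩ H h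

/-- The set of vertices in the `K`-ball around `i` of the Euclidean neighbourhood graph
`F^{𝔾_n}_i(r)`, viewed as a subset of the vertex set of `𝔾_n`. -/
def SIRGModel.spatialBall (M : SIRGModel d Ω) (n : ℕ) (ω : Ω) (i : Fin n) (r : ℝ)
    (K : ℕ) : Set (Fin n) :=
  {v | ∃ (hi : i ∈ M.euclSet n ω i r) (hv : v ∈ M.euclSet n ω i r),
      (⟨v, hv⟩ : M.euclSet n ω i r) ∈ graphBall (M.euclNbhd n ω i r) ⟨i, hi⟩ K}

/-- Empirical frequency of the rooted graph `(H,h)` among the Euclidean `r`-neighbourhoods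
`F^{𝔾_n}_i(r)`, `i ∈ [n]`. -/
noncomputable def SIRGModel.empNbhdFreq (M : SIRGModel d Ω) (n : ℕ) (r : ℝ)
    {V : Type*} (H : SimpleGraph V) (h : V) (ω : Ω) : ℝ :=
  (∑ i : Fin n, indic (M.euclNbhdIso n ω i r H h)) / n

/-- Empirical frequency of the rooted graph `(H,h)` among the rooted `K`-balls of `𝔾_n`. -/
noncomputable def SIRGModel.empBallFreq (M : SIRGModel d Ω) (n K : ℕ)
    {V : Type*} (H : SimpleGraph V) (h : V) (ω : Ω) : ℝ :=
  (∑ i : Fin n, indic (ballIso (M.graph n ω) i K H h)) / n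

/-- Prepend the origin to a tuple of points. -/
def withZero {d l : ℕ} (z : Fin l → Euc d) : Fin (l + 1) → Euc d :=
  Fin.cases 0 z

/-- The limiting graph on `l+1` vertices built from locations `0, z 0, …, z (l-1)`, weights `w`
and uniform variables `u`, with connection function `κ`. -/
def limitGraph (d : ℕ) (κ : ℝ → ℝ → ℝ → ℝ) (l : ℕ) (z : Fin l → Euc d)
    (w : Fin (l + 1) → ℝ) (u : Fin (l + 1) → Fin (l + 1) → ℝ) : SimpleGraph (Fin (l + 1)) :=
  SimpleGraph.fromRel (fun i j =>
    i < j ∧ u i j ≤ κ (dist (withZero z i) (withZero z j)) (w i) (w j))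

/-- Poisson probability mass function with mean `lam`. -/
noncomputable def poissonWeight (lam : ℝ≥0∞) (k : ℕ) : ℝ≥0∞ :=
  ENNReal.ofReal (Real.exp (-(lam.toReal)) * lam.toReal ^ k / (Nat.factorial k))

/-- The probability that the Poissonized limiting Euclidean `r`-neighbourhood `F_r`
(rooted at the vertex `0` located at the origin) is rooted-isomorphic to `(H,h)`:
the number `N` of non-root vertices is Poisson with mean `λ_d(B_r)`; given `N = l`, the
non-root locations are i.i.d. uniform on `B_r`, the `l+1` weights are i.i.d. with law `μW`,
and, given everything, edges are present independently with probabilities given by `κ`. -/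
noncomputable def limitNbhdProb (d : ℕ) (κ : ℝ → ℝ → ℝ → ℝ) (μW : Measure ℝ) (r : ℝ)
    {V : Type*} (H : SimpleGraph V) (h : V) : ℝ≥0∞ :=
  ∑' l : ℕ,
    poissonWeight (volume (Metric.ball (0 : Euc d) r)) l *
      ((Measure.pi fun _ : Fin l => unifBall d r).prod
          ((Measure.pi fun _ : Fin (l + 1) => μW).prod
            (Measure.pi fun _ : Fin (l + 1) => Measure.pi fun _ : Fin (l + 1) => unif01)))
        {zwu : (Fin l → Euc d) × (Fin (l + 1) → ℝ) × (Fin (l + 1) → Fin (l + 1) → ℝ) |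
          RootedIso (limitGraph d κ l zwu.1 zwu.2.1 zwu.2.2) 0 H h}

/-- The path expectation
`E[∏_{i=1}^{j} κ_n(‖x_i − x_{i-1}‖, W^{(n)}_{V_{i-1}}, W^{(n)}_{V_i})]`, where
`V_0, …, V_j` are i.i.d. uniform indices on `[n]`, independent of the weights `W^{(n)}`. -/
noncomputable def SIRGModel.pathExp (M : SIRGModel d Ω) (n j : ℕ)
    (x : Fin (j + 1) → Euc d) : ℝ :=
  ∫ ω, (∑ v : Fin (j + 1) → Fin n,
      ∏ i : Fin j,
        M.κn n (dist (x i.succ) (x i.castSucc)) (M.Wt n (v i.castSucc) ω)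
          (M.Wt n (v i.succ) ω)) / (n : ℝ) ^ (j + 1) ∂M.P

/-- `𝕎_j(x_0, …, x_j) = E[∏_{i=1}^{j} κ(‖x_i − x_{i-1}‖, W^{(i-1)}, W^{(i)})]` with
`W^{(0)}, …, W^{(j)}` i.i.d. with law `μW`. -/
noncomputable def Wfun (d : ℕ) (κ : ℝ → ℝ → ℝ → ℝ) (μW : Measure ℝ) (j : ℕ)
    (x : Fin (j + 1) → Euc d) : ℝ :=
  ∫ w : Fin (j + 1) → ℝ,
    ∏ i : Fin j, κ (dist (x i.succ) (x i.castSucc)) (w i.castSucc) (w i.succ)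
    ∂(Measure.pi fun _ : Fin (j + 1) => μW)

/-- The product of indicators
`∏_{i=1}^{j-1} 1{‖x_i − x_{i-1}‖ < a^{m^i}} · 1{‖x_j − x_{j-1}‖ > a^{m^j}}`. -/
noncomputable def pathIndic {d : ℕ} (j : ℕ) (a m : ℝ) (x : Fin (j + 1) → Euc d) : ℝ≥0∞ :=
  ∏ i : Fin j,
    if i.val + 1 < j then
      (if dist (x i.succ) (x i.castSucc) < a ^ (m ^ (i.val + 1)) then 1 else 0)
    else
      (if a ^ (m ^ j) < dist (x i.succ) (x i.castSucc) then 1 else 0)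

/-- The indicator of `z_k ∈ B(a^{m^k})` for `1 ≤ k ≤ j-1` and `z_j ∉ B(a^{m^j})`
(with `z` indexed by `Fin j`, so `z i` stands for `z_{i+1}`). -/
noncomputable def shellIndic {d : ℕ} (j : ℕ) (a m : ℝ) (z : Fin j → Euc d) : ℝ≥0∞ :=
  ∏ i : Fin j,
    if i.val + 1 < j then
      (if ‖z i‖ < a ^ (m ^ (i.val + 1)) then 1 else 0)
    else
      (if a ^ (m ^ j) ≤ ‖z i‖ then 1 else 0)

/-- The expectation `E[κ_n(t, W^{(n)}_{V_1}, W^{(n)}_{V_2})]`, where `V_1, V_2` are i.i.d.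
uniform indices on `[n]`, independent of the weights. -/
noncomputable def SIRGModel.expKn (M : SIRGModel d Ω) (n : ℕ) (t : ℝ) : ℝ :=
  ∫ ω, (∑ v : Fin n × Fin n, M.κn n t (M.Wt n v.1 ω) (M.Wt n v.2 ω)) / (n : ℝ) ^ 2 ∂M.P

/-- The radius `r(a, m, K) = a^m + a^{m^2} + ⋯ + a^{m^K}`. -/
noncomputable def rr (a m : ℝ) (K : ℕ) : ℝ :=
  ∑ k ∈ Finset.range K, a ^ (m ^ (k + 1))

/-- Assumptions (A1)–(A2): convergence in probability of the empirical weight distribution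
to the law `μW` of the limiting weight (at every continuity point of its cdf), and
convergence of the connection functions `κn` to a limiting connection function `κ`. -/
structure SIRGWeakAssumptions {d : ℕ} {Ω : Type} [MeasurableSpace Ω] (M : SIRGModel d Ω) where
  μW : Measure ℝ
  probμW : IsProbabilityMeasure μW
  weights_conv : ∀ x : ℝ, μW {x} = 0 →
    TendstoInMeasure M.P
      (fun n ω => (∑ i : Fin n, indic (M.Wt n i ω ≤ x)) / n) atTop
      (fun _ => (μW (Set.Iic x)).toReal)
  κ : ℝ → ℝ → ℝ → ℝ
  κ_meas : Measurable fun p : ℝ × ℝ × ℝ => κ p.1 p.2.1 p.2.2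
  κ_nonneg : ∀ t x y, 0 < t → 0 ≤ κ t x y
  κ_le_one : ∀ t x y, 0 < t → κ t x y ≤ 1
  κ_symm : ∀ t x y, κ t x y = κ t y x
  κ_conv : ∀ (x y : ℝ) (xs ys : ℕ → ℝ),
      Tendsto xs atTop (𝓝 x) → Tendsto ys atTop (𝓝 y) →
      ∀ᵐ t ∂(volume : Measure ℝ), 0 < t →
        Tendsto (fun n => M.κn n t (xs n) (ys n)) atTop (𝓝 (κ t x y))

/-- Assumptions (A1)–(A3): additionally, the polynomial tail bound
`E[κ(t, W^{(1)}, W^{(2)})] ≤ t^{-α}` with `α > d`, for all `t > t₀`. -/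
structure SIRGAssumptions {d : ℕ} {Ω : Type} [MeasurableSpace Ω] (M : SIRGModel d Ω)
    extends SIRGWeakAssumptions M where
  t₀ : ℝ
  α : ℝ
  t₀_pos : 0 < t₀
  α_gt_dim : (d : ℝ) < α
  κ_tail : ∀ t : ℝ, t₀ < t →
      ∫ p : ℝ × ℝ, κ t p.1 p.2 ∂(μW.prod μW) ≤ t ^ (-α)



/-- Reindexing a product measure along an injection. -/
theorem pi_comp_inj {A B X : Type*} [Fintype A] [Fintype B] [MeasurableSpace X]
    (μ : Measure X) [IsProbabilityMeasure μ] (f : A → B) (hf : Function.Injective f) :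
    MeasurePreserving (fun (u : B → X) (a : A) => u (f a))
      (Measure.pi fun _ : B => μ) (Measure.pi fun _ : A => μ) := by
  have hm : ∀ b : B, AEMeasurable (fun u : B → X => u b) (Measure.pi fun _ : B => μ) :=
    fun b => (measurable_pi_apply b).aemeasurable
  refine ⟨by fun_prop, ?_⟩
  have h1 : iIndepFun (fun (b : B) (u : B → X) => u b) (Measure.pi fun _ : B => μ) :=
    iIndepFun_pi (X := fun _ x => x) (fun _ => aemeasurable_id)
  have h2 := h1.precomp hf
  have h3 := (iIndepFun_iff_map_fun_eq_pi_map (fun a => hm (f a))).1 h2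
  rw [h3]
  congr 1
  ext1 a
  exact (measurePreserving_eval (fun _ : B => μ) (f a)).map_eq

theorem pi_smul_meas {l : ℕ} {X : Type*} [MeasurableSpace X]
    (μ : Measure X) [IsFiniteMeasure μ] (c : ℝ≥0∞) (hc : c ≠ ∞) :
    (Measure.pi fun _ : Fin l => c • μ) = c ^ l • Measure.pi fun _ : Fin l => μ := by
  have : IsFiniteMeasure (c • μ) := Measure.smul_finite μ hc
  refine Measure.pi_eq fun s _ => ?_
  simp [Measure.pi_pi, Finset.prod_mul_distrib]

theorem volume_cube (d : ℕ) (s : ℝ) (hs : 0 ≤ s) :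
    volume {x : Euc d | ∀ i, |x i| ≤ s} = ENNReal.ofReal (2 * s) ^ d := by
  have e : {x : Euc d | ∀ i, |x i| ≤ s} =
      (MeasurableEquiv.toLp 2 (Fin d → ℝ)).symm ⁻¹'
        (Set.pi Set.univ fun _ : Fin d => Set.Icc (-s) s) := by
    ext x; simp [abs_le, Pi.le_def, forall_and]
  have h3 := (EuclideanSpace.volume_preserving_symm_measurableEquiv_toLp
    (Fin d)).measure_preimage_equiv (Set.pi Set.univ fun _ : Fin d => Set.Icc (-s) s)
  rw [e, h3, volume_pi_pi]
  simp only [Real.volume_Icc, Finset.prod_const, Finset.card_univ, Fintype.card_fin]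
  ring_nf

theorem measurableSet_cube (d : ℕ) (s : ℝ) : MeasurableSet {x : Euc d | ∀ i, |x i| ≤ s} := by
  have : {x : Euc d | ∀ i, |x i| ≤ s} = ⋂ i, {x : Euc d | |x i| ≤ s} := by ext; simp
  rw [this]
  refine MeasurableSet.iInter fun i => ?_
  exact measurableSet_le (by fun_prop) measurable_const

theorem volume_boxIn (d n : ℕ) (hd : 1 ≤ d) : volume (boxIn d n) = n := by
  unfold boxIn
  rw [volume_cube _ _ (by positivity), ← ENNReal.ofReal_pow (by positivity)]
  have : (2 * ((n : ℝ) ^ ((1 : ℝ) / d) / 2)) ^ d = n := by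
    rw [mul_div_cancel₀ _ (by norm_num), ← Real.rpow_natCast, ← Real.rpow_mul (by positivity)]
    rw [one_div_mul_cancel (by positivity), Real.rpow_one]
  rw [this]; simp

theorem prob_unifBox (d n : ℕ) (hd : 1 ≤ d) (hn : 1 ≤ n) : IsProbabilityMeasure (unifBox d n) := by
  constructor
  simp only [unifBox, Measure.smul_apply, Measure.restrict_apply_univ, volume_boxIn d n hd, smul_eq_mul]
  exact ENNReal.inv_mul_cancel (by simp; omega) (by simp)

instance prob_unif01 : IsProbabilityMeasure unif01 := by
  constructor; simp [unif01]

theorem vol_ball_ne_zero (d : ℕ) (r : ℝ) (hr : 0 < r) : volume (Metric.ball (0 : Euc d) r) ≠ 0 :=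
  (Metric.measure_ball_pos volume _ hr).ne'

theorem vol_ball_ne_top (d : ℕ) (r : ℝ) : volume (Metric.ball (0 : Euc d) r) ≠ ∞ :=
  measure_ball_lt_top.ne

theorem prob_unifBall (d : ℕ) (r : ℝ) (hr : 0 < r) : IsProbabilityMeasure (unifBall d r) := by
  constructor
  simp only [unifBall, Measure.smul_apply, Measure.restrict_apply_univ, smul_eq_mul]
  exact ENNReal.inv_mul_cancel (vol_ball_ne_zero d r hr) (vol_ball_ne_top d r)

/-- Clip a real into `[0,1]`. -/
def clip (p : ℝ) : ℝ := max 0 (min p 1)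

theorem clip_nonneg (p : ℝ) : 0 ≤ clip p := le_max_left _ _
theorem clip_le_one (p : ℝ) : clip p ≤ 1 := max_le zero_le_one (min_le_right _ _)
theorem continuous_clip : Continuous clip := by unfold clip; fun_prop

theorem unif01_Iic (p : ℝ) : unif01 {u | u ≤ p} = ENNReal.ofReal (clip p) := by
  have : {u | u ≤ p} = Set.Iic p := rfl
  rw [this, unif01, Measure.restrict_apply measurableSet_Iic, Set.inter_comm, ← Set.Ici_inter_Iic,
    Set.inter_assoc, Set.Iic_inter_Iic, Set.Ici_inter_Iic, Real.volume_Icc, clip]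
  simp [min_comm]

theorem unif01_Ioi (p : ℝ) : unif01 {u | ¬ u ≤ p} = ENNReal.ofReal (1 - clip p) := by
  have hm : MeasurableSet {u : ℝ | u ≤ p} := measurableSet_Iic
  have : {u | ¬ u ≤ p} = {u | u ≤ p}ᶜ := rfl
  rw [this, prob_compl_eq_one_sub hm, unif01_Iic, ENNReal.ofReal_sub _ (clip_nonneg p)]
  simp

open Classical in
/-- Edge factor. -/
def efac (b : Prop) (p : ℝ) : ℝ := if b then clip p else 1 - clip p

theorem unif01_efac (b : Prop) (p : ℝ) : unif01 {u | u ≤ p ↔ b} = ENNReal.ofReal (efac b p) := by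
  by_cases hb : b
  · simp [efac, hb, unif01_Iic]
  · simp only [efac, hb, iff_false, if_false]; exact unif01_Ioi p

theorem efac_nonneg (b : Prop) (p : ℝ) : 0 ≤ efac b p := by
  unfold efac; split_ifs
  · exact clip_nonneg p
  · linarith [clip_le_one p]
theorem efac_le_one (b : Prop) (p : ℝ) : efac b p ≤ 1 := by
  unfold efac; split_ifs
  · exact clip_le_one p
  · linarith [clip_nonneg p]
theorem continuous_efac (b : Prop) : Continuous (efac b) := by
  unfold efac; split_ifs
  · exact continuous_clip
  · exact continuous_const.sub continuous_clip

theorem measurableSet_efac (b : Prop) (p : ℝ) : MeasurableSet {u : ℝ | u ≤ p ↔ b} := by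
  by_cases hb : b
  · simp only [hb, iff_true]; exact measurableSet_Iic
  · simp only [hb, iff_false, not_le]; exact measurableSet_Ioi

/-- Product of edge factors over pairs `i < j`. -/
def phi {k : ℕ} (G : SimpleGraph (Fin k)) (p : Fin k → Fin k → ℝ) : ℝ :=
  ∏ e : {e : Fin k × Fin k // e.1 < e.2}, efac (G.Adj e.1.1 e.1.2) (p e.1.1 e.1.2)

theorem phi_nonneg {k : ℕ} (G : SimpleGraph (Fin k)) (p : Fin k → Fin k → ℝ) : 0 ≤ phi G p :=
  Finset.prod_nonneg fun _ _ => efac_nonneg _ _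
theorem phi_le_one {k : ℕ} (G : SimpleGraph (Fin k)) (p : Fin k → Fin k → ℝ) : phi G p ≤ 1 :=
  Finset.prod_le_one (fun _ _ => efac_nonneg _ _) (fun _ _ => efac_le_one _ _)
theorem continuous_phi {k : ℕ} (G : SimpleGraph (Fin k)) : Continuous (phi G) := by
  unfold phi
  refine continuous_finsetProd _ fun e _ => ?_
  exact (continuous_efac _).comp (by fun_prop)

theorem phi_eq_pairs {k : ℕ} (G : SimpleGraph (Fin k)) (p : Fin k → Fin k → ℝ) :
    (Measure.pi fun _ : {e : Fin k × Fin k // e.1 < e.2} => unif01)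
      {u | ∀ e, u e ≤ p e.1.1 e.1.2 ↔ G.Adj e.1.1 e.1.2} = ENNReal.ofReal (phi G p) := by
  have : {u : {e : Fin k × Fin k // e.1 < e.2} → ℝ | ∀ e, u e ≤ p e.1.1 e.1.2 ↔ G.Adj e.1.1 e.1.2} =
      Set.pi Set.univ (fun e => {x : ℝ | x ≤ p e.1.1 e.1.2 ↔ G.Adj e.1.1 e.1.2}) := by
    ext; simp
  rw [this, Measure.pi_pi, phi, ENNReal.ofReal_prod_of_nonneg (fun _ _ => efac_nonneg _ _)]
  simp [unif01_efac]

/-- Random graph with thresholds `p` and variables `u`. -/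
def gOf {k : ℕ} (p u : Fin k → Fin k → ℝ) : SimpleGraph (Fin k) :=
  SimpleGraph.fromRel (fun i j => i < j ∧ u i j ≤ p i j)

theorem gOf_adj_lt {k : ℕ} (p u : Fin k → Fin k → ℝ) {i j : Fin k} (h : i < j) :
    (gOf p u).Adj i j ↔ u i j ≤ p i j := by
  simp [gOf, h, h.ne, h.not_gt]

theorem graph_eq_iff {k : ℕ} (G G' : SimpleGraph (Fin k)) :
    G = G' ↔ ∀ e : {e : Fin k × Fin k // e.1 < e.2}, G.Adj e.1.1 e.1.2 ↔ G'.Adj e.1.1 e.1.2 := by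
  constructor
  · rintro rfl e; rfl
  · intro h
    ext i j
    rcases lt_trichotomy i j with hij | hij | hij
    · exact h ⟨(i, j), hij⟩
    · subst hij; simp
    · rw [G.adj_comm, G'.adj_comm]; exact h ⟨(j, i), hij⟩

theorem phi_eq_full {k : ℕ} (G : SimpleGraph (Fin k)) (p : Fin k → Fin k → ℝ) :
    (Measure.pi fun _ : Fin k => Measure.pi fun _ : Fin k => unif01)
      {u | gOf p u = G} = ENNReal.ofReal (phi G p) := by
  classical
  have : {u : Fin k → Fin k → ℝ | gOf p u = G} =
      Set.pi Set.univ (fun i => Set.pi Set.univ fun j =>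
        if i < j then {x : ℝ | x ≤ p i j ↔ G.Adj i j} else Set.univ) := by
    ext u
    simp only [Set.mem_ofPred_eq, Set.mem_pi, Set.mem_univ, true_imp_iff, graph_eq_iff]
    constructor
    · intro h i j
      split_ifs with hij
      · rw [Set.mem_ofPred_eq, ← gOf_adj_lt p u hij]; exact h ⟨(i, j), hij⟩
      · trivial
    · rintro h ⟨⟨i, j⟩, hij⟩
      have := h i j
      simp only at hij
      rw [if_pos hij] at this
      rw [gOf_adj_lt p u hij]; exact this
  rw [this, Measure.pi_pi]
  simp only [Measure.pi_pi]
  rw [← Finset.prod_product', phi, ENNReal.ofReal_prod_of_nonneg (fun _ _ => efac_nonneg _ _)]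
  rw [Finset.univ_product_univ]
  rw [← Finset.prod_subtype (Finset.univ.filter fun e : Fin k × Fin k => e.1 < e.2) (by simp)
    (f := fun e : Fin k × Fin k => ENNReal.ofReal (efac (G.Adj e.1 e.2) (p e.1 e.2)))]
  rw [Finset.prod_filter]
  refine Finset.prod_congr rfl fun e _ => ?_
  split_ifs
  · rw [unif01_efac]
  · simp

/-- The box shrunk by `r`. -/
def inBox (d n : ℕ) (r : ℝ) : Set (Euc d) :=
  {x | ∀ i, |x i| ≤ ((n : ℝ) ^ ((1 : ℝ) / d)) / 2 - r}

theorem measurableSet_inBox (d n : ℕ) (r : ℝ) : MeasurableSet (inBox d n r) :=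
  measurableSet_cube d _

theorem measurableSet_boxIn (d n : ℕ) : MeasurableSet (boxIn d n) :=
  measurableSet_cube d _

theorem ball_sub_box {d n : ℕ} {r : ℝ} {x : Euc d} (hx : x ∈ inBox d n r) :
    Metric.ball x r ⊆ boxIn d n := by
  intro y hy i
  have h1 := hx i
  have h2 : |y i - x i| ≤ dist y x := by
    rw [dist_eq_norm]
    exact PiLp.norm_apply_le (y - x) i
  have h3 : dist y x < r := hy
  have h4 : |y i| ≤ |y i - x i| + |x i| := by
    have := abs_add_le (y i - x i) (x i); simpa using this
  linarith

/-- Volume of the ball of radius `r`. -/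
def lamB (d : ℕ) (r : ℝ) : ℝ≥0∞ := volume (Metric.ball (0 : Euc d) r)

theorem unifBox_restrict_ball {d n : ℕ} {r : ℝ} (hr : 0 < r) {x : Euc d} (hx : x ∈ inBox d n r) :
    (unifBox d n).restrict (Metric.ball x r) =
      ((lamB d r * (n : ℝ≥0∞)⁻¹) • unifBall d r).map (fun z => z + x) := by
  have h1 : (lamB d r * (n : ℝ≥0∞)⁻¹) • unifBall d r =
      (n : ℝ≥0∞)⁻¹ • volume.restrict (Metric.ball (0 : Euc d) r) := by
    rw [unifBall, smul_smul, mul_assoc, mul_comm _ (volume _)⁻¹, ← mul_assoc, lamB,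
      ENNReal.mul_inv_cancel (vol_ball_ne_zero d r hr) (vol_ball_ne_top d r), one_mul]
  rw [h1, unifBox, Measure.restrict_smul, Measure.map_smul, Measure.restrict_restrict measurableSet_ball,
    Set.inter_eq_left.2 (ball_sub_box hx)]
  congr 1
  have h2 := (measurePreserving_add_right (volume : Measure (Euc d)) x).restrict_preimage
    (measurableSet_ball (x := x) (ε := r))
  have h3 : (fun z => z + x) ⁻¹' (Metric.ball x r) = Metric.ball (0 : Euc d) r := by
    ext z; simp [dist_eq_norm]
  rw [h3] at h2
  exact h2.map_eq.symm

theorem unifBox_ball {d n : ℕ} {r : ℝ} (hr : 0 < r) {x : Euc d} (hx : x ∈ inBox d n r) :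
    unifBox d n (Metric.ball x r) = lamB d r * (n : ℝ≥0∞)⁻¹ := by
  have := prob_unifBall d r hr
  rw [← Measure.restrict_apply_univ, unifBox_restrict_ball hr hx,
    Measure.map_apply (by fun_prop) MeasurableSet.univ]
  simp

/-- Geometric event. -/
def goodSet (d n : ℕ) (r : ℝ) {l : ℕ} (v : Fin (l + 1) → Fin n) : Set (Fin n → Euc d) :=
  {y | y (v 0) ∈ inBox d n r ∧ (∀ i, dist (y (v i)) (y (v 0)) < r) ∧
    ∀ j, j ∉ Set.range v → ¬ dist (y j) (y (v 0)) < r}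

theorem measurableSet_goodSet (d n : ℕ) (r : ℝ) {l : ℕ} (v : Fin (l + 1) → Fin n) :
    MeasurableSet (goodSet d n r v) := by
  have e : goodSet d n r v = (fun y : Fin n → Euc d => y (v 0)) ⁻¹' (inBox d n r) ∩
      ((⋂ i, {y | dist (y (v i)) (y (v 0)) < r}) ∩
      ⋂ j, ⋂ (_ : j ∉ Set.range v), {y : Fin n → Euc d | r ≤ dist (y j) (y (v 0))}) := by
    ext y; simp [goodSet]
  rw [e]
  refine MeasurableSet.inter ((measurableSet_inBox d n r).preimage (by fun_prop)) (MeasurableSet.inter ?_ ?_)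
  · exact MeasurableSet.iInter fun i => measurableSet_lt (by fun_prop) measurable_const
  · exact MeasurableSet.iInter fun j => MeasurableSet.iInter fun _ =>
      measurableSet_le measurable_const (by fun_prop)

/-- Step 1: integrating out the points outside the range. -/
theorem geom_one {d n : ℕ} (hd : 1 ≤ d) (hn : 1 ≤ n) {r : ℝ} (hr : 0 < r) {l : ℕ}
    (v : Fin (l + 1) → Fin n) (hv : Function.Injective v)
    (f : (Fin (l + 1) → Euc d) → ℝ≥0∞) (hf : Measurable f) :
    ∫⁻ y in goodSet d n r v, f (fun i => y (v i)) ∂(Measure.pi fun _ : Fin n => unifBox d n) =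
    (1 - lamB d r * (n : ℝ≥0∞)⁻¹) ^ (n - (l + 1)) *
    ∫⁻ a in {a : Fin (l + 1) → Euc d | a 0 ∈ inBox d n r ∧ ∀ i, dist (a i) (a 0) < r},
      f a ∂(Measure.pi fun _ : Fin (l + 1) => unifBox d n) := by
  classical
  have := prob_unifBox d n hd hn
  let C := {j : Fin n // j ∉ Set.range v}
  let g : Fin (l + 1) ⊕ C → Fin n := Sum.elim v Subtype.val
  have hg : Function.Injective g := by
    rintro (a | a) (b | b) h
    · exact congrArg _ (hv h)
    · exact absurd ⟨a, h⟩ b.2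
    · exact absurd ⟨b, h.symm⟩ a.2
    · exact congrArg _ (Subtype.ext h)
  have hcard : Fintype.card C = n - (l + 1) := by
    have : Fintype.card C = Fintype.card (Fin n) - Fintype.card {j : Fin n // j ∈ Set.range v} :=
      Fintype.card_subtype_compl _
    rw [this]
    simp only [Fintype.card_fin]
    congr 1
    rw [← Fintype.card_congr (Equiv.ofInjective v hv), Fintype.card_fin]
  have mp := (measurePreserving_sumPiEquivProdPi
    (X := fun _ : Fin (l + 1) ⊕ C => Euc d) (fun _ => unifBox d n)).comp
    (pi_comp_inj (unifBox d n) g hg)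
  set A : Set (Fin (l + 1) → Euc d) := {a | a 0 ∈ inBox d n r ∧ ∀ i, dist (a i) (a 0) < r} with hA
  have hAm : MeasurableSet A := by
    have e : A = (fun y : Fin (l + 1) → Euc d => y 0) ⁻¹' (inBox d n r) ∩
      (⋂ i, {y | dist (y i) (y 0) < r}) := by
      ext y; simp [hA]
    rw [e]
    exact MeasurableSet.inter ((measurableSet_inBox d n r).preimage (by fun_prop))
      (MeasurableSet.iInter fun i => measurableSet_lt (by fun_prop) measurable_const)
  let S : Set ((Fin (l + 1) → Euc d) × (C → Euc d)) :=
    {p | p.1 ∈ A ∧ ∀ j, ¬ dist (p.2 j) (p.1 0) < r}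
  have hSm : MeasurableSet S := by
    have e : S = Prod.fst ⁻¹' A ∩ ⋂ j, {p : (Fin (l + 1) → Euc d) × (C → Euc d) | r ≤ dist (p.2 j) (p.1 0)} := by
      ext p; simp [S]
    rw [e]
    exact (hAm.preimage measurable_fst).inter (MeasurableSet.iInter fun j =>
      measurableSet_le measurable_const (by fun_prop))
  have key := mp.setLIntegral_comp_preimage (s := S) hSm (f := fun p => f p.1) (hf.comp measurable_fst)
  have hpre : (⇑(MeasurableEquiv.sumPiEquivProdPi fun _ : Fin (l + 1) ⊕ C => Euc d) ∘
      fun (u : Fin n → Euc d) a => u (g a)) ⁻¹' S = goodSet d n r v := by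
    ext y
    simp only [S, hA, goodSet, Set.mem_preimage, Function.comp_def, Set.mem_ofPred_eq, and_assoc]
    constructor
    · rintro ⟨h1, h2, h3⟩
      exact ⟨h1, h2, fun j hj => h3 ⟨j, hj⟩⟩
    · rintro ⟨h1, h2, h3⟩
      exact ⟨h1, h2, fun j => h3 j.1 j.2⟩
  rw [hpre] at key
  have key' : ∫⁻ y in goodSet d n r v, f (fun i => y (v i)) ∂(Measure.pi fun _ : Fin n => unifBox d n) =
    ∫⁻ p in S, f p.1 ∂((Measure.pi fun _ : Fin (l + 1) => unifBox d n).prod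
      (Measure.pi fun _ : C => unifBox d n)) := key
  have hfm : Measurable (S.indicator fun p => f p.1) := (hf.comp measurable_fst).indicator hSm
  rw [key', ← lintegral_indicator hSm, lintegral_prod _ hfm.aemeasurable]
  rw [← lintegral_indicator hAm, ← lintegral_const_mul' _ _ (by finiteness)]
  congr 1
  ext a
  by_cases ha : a ∈ A
  · rw [Set.indicator_of_mem ha]
    have : (fun b => S.indicator (fun p => f p.1) (a, b)) =
        Set.indicator (Set.pi Set.univ fun _ : C => (Metric.ball (a 0) r)ᶜ) (fun _ => f a) := by
      ext b
      simp only [Set.indicator, S, ha, Set.mem_ofPred_eq, true_and, Set.mem_pi, Set.mem_univ,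
        true_imp_iff, Set.mem_compl_iff, Metric.mem_ball]
    rw [this, lintegral_indicator (MeasurableSet.univ_pi fun _ => measurableSet_ball.compl)]
    rw [setLIntegral_const, Measure.pi_pi, prob_compl_eq_one_sub measurableSet_ball,
      unifBox_ball hr ha.1, Finset.prod_const, Finset.card_univ, hcard, mul_comm]
  · rw [Set.indicator_of_notMem ha]
    simp [Set.indicator, S, ha]

theorem geom_two {d n : ℕ} (hd : 1 ≤ d) (hn : 1 ≤ n) {r : ℝ} (hr : 0 < r) {l : ℕ}
    (f : (Fin (l + 1) → Euc d) → ℝ≥0∞) (hf : Measurable f)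
    (hinv : ∀ a c, f (fun i => a i + c) = f a) :
    ∫⁻ a in {a : Fin (l + 1) → Euc d | a 0 ∈ inBox d n r ∧ ∀ i, dist (a i) (a 0) < r},
      f a ∂(Measure.pi fun _ : Fin (l + 1) => unifBox d n) =
    unifBox d n (inBox d n r) * ((lamB d r * (n : ℝ≥0∞)⁻¹) ^ l *
      ∫⁻ z, f (withZero z) ∂(Measure.pi fun _ : Fin l => unifBall d r)) := by
  have := prob_unifBox d n hd hn
  have := prob_unifBall d r hr
  have hc : lamB d r * (n : ℝ≥0∞)⁻¹ ≠ ∞ := by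
    refine ENNReal.mul_ne_top (vol_ball_ne_top d r) ?_
    simp; omega
  have mp := (measurePreserving_piFinSuccAbove (fun _ : Fin (l + 1) => unifBox d n) 0).symm
  set A : Set (Fin (l + 1) → Euc d) := {a | a 0 ∈ inBox d n r ∧ ∀ i, dist (a i) (a 0) < r} with hA
  have hAm : MeasurableSet A := by
    have e : A = (fun y : Fin (l + 1) → Euc d => y 0) ⁻¹' (inBox d n r) ∩
      (⋂ i, {y | dist (y i) (y 0) < r}) := by
      ext y; simp [hA]
    rw [e]
    exact MeasurableSet.inter ((measurableSet_inBox d n r).preimage (by fun_prop))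
      (MeasurableSet.iInter fun i => measurableSet_lt (by fun_prop) measurable_const)
  have hcons : Measurable (fun p : Euc d × (Fin l → Euc d) =>
      (Fin.cons p.1 p.2 : Fin (l + 1) → Euc d)) := by
    refine measurable_pi_lambda _ fun i => ?_
    refine Fin.cases ?_ (fun i => ?_) i
    · simpa using measurable_fst
    · simp only [Fin.cons_succ]; fun_prop
  rw [← lintegral_indicator hAm, ← mp.lintegral_comp (hf.indicator hAm)]
  have e1 : ∀ p : Euc d × (Fin l → Euc d),
      (MeasurableEquiv.piFinSuccAbove (fun _ : Fin (l + 1) => Euc d) 0).symm p = Fin.cons p.1 p.2 := by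
    intro p
    rw [MeasurableEquiv.symm_apply_eq]
    exact (Prod.ext (by simp [MeasurableEquiv.piFinSuccAbove]) (by ext1 i; simp [MeasurableEquiv.piFinSuccAbove, Fin.removeNth]))
  simp only [e1]
  have hfm : Measurable fun p : Euc d × (Fin l → Euc d) => A.indicator f (Fin.cons p.1 p.2) :=
    (hf.indicator hAm).comp hcons
  rw [lintegral_prod _ hfm.aemeasurable]
  have e2 : ∀ x : Euc d, ∫⁻ b, A.indicator f (Fin.cons x b) ∂(Measure.pi fun _ : Fin l => unifBox d n) =
      (inBox d n r).indicator (fun _ => (lamB d r * (n : ℝ≥0∞)⁻¹) ^ l *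
      ∫⁻ z, f (withZero z) ∂(Measure.pi fun _ : Fin l => unifBall d r)) x := by
    intro x
    by_cases hx : x ∈ inBox d n r
    · rw [Set.indicator_of_mem hx]
      have : (fun b => A.indicator f (Fin.cons x b)) =
        Set.indicator (Set.pi Set.univ fun _ : Fin l => (Metric.ball x r)) (fun b => f (Fin.cons x b)) := by
        ext b
        simp only [Set.indicator, hA, hx, Set.mem_ofPred_eq, true_and, Set.mem_pi, Set.mem_univ,
          true_imp_iff, Metric.mem_ball, Fin.forall_fin_succ, Fin.cons_zero, Fin.cons_succ, dist_self, hr]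
      rw [this, lintegral_indicator (MeasurableSet.univ_pi fun _ => measurableSet_ball)]
      rw [Measure.restrict_pi_pi]
      have hs : IsFiniteMeasure ((lamB d r * (n : ℝ≥0∞)⁻¹) • unifBall d r) := Measure.smul_finite _ hc
      simp only [unifBox_restrict_ball hr hx]
      rw [← Measure.pi_map_pi (f := fun _ z => z + x) (fun _ => by fun_prop)]
      have hcx : Measurable (fun b : Fin l → Euc d => f (Fin.cons x b : Fin (l + 1) → Euc d)) :=
        hf.comp (hcons.comp (measurable_const.prodMk measurable_id))
      rw [lintegral_map hcx (by fun_prop)]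
      rw [pi_smul_meas _ _ hc, lintegral_smul_measure, smul_eq_mul]
      congr 1
      congr 1
      ext z
      rw [← hinv (withZero z) x]
      congr 1
      ext1 i
      refine Fin.cases ?_ (fun i => ?_) i
      · simp [withZero]
      · simp [withZero]
    · rw [Set.indicator_of_notMem hx]
      simp [Set.indicator, hA, hx]
  simp only [e2]
  rw [lintegral_indicator (measurableSet_inBox d n r), setLIntegral_const, mul_comm]

theorem norm_ae {d : ℕ} (hd : 1 ≤ d) {N : Set ℝ} (hNm : MeasurableSet N) (hN : volume N = 0) :
    ∀ᵐ x : Euc d, ‖x‖ ∉ N := by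
  have : Nonempty (Fin d) := ⟨⟨0, hd⟩⟩
  have : Nontrivial (Euc d) := inferInstance
  have h0 : (fun y : ℝ => y ^ (Module.finrank ℝ (Euc d) - 1) • N.indicator (fun _ => (1 : ℝ)) y)
      =ᵐ[volume.restrict (Set.Ioi 0)] 0 := by
    refine ae_restrict_of_ae ?_
    have : ∀ᵐ y : ℝ, y ∉ N := by rw [ae_iff]; simpa using hN
    filter_upwards [this] with y hy
    simp [hy]
  have hi : Integrable (fun x : Euc d => N.indicator (fun _ => (1 : ℝ)) ‖x‖) := by
    rw [integrable_fun_norm_addHaar (volume : Measure (Euc d))]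
    exact (integrable_congr h0).2 (integrable_zero _ _ _)
  have h1 : ∫ x : Euc d, N.indicator (fun _ => (1 : ℝ)) ‖x‖ = 0 := by
    rw [integral_fun_norm_addHaar (volume : Measure (Euc d)), integral_congr_ae h0]
    simp
  rw [integral_eq_zero_iff_of_nonneg (fun x => Set.indicator_nonneg (fun _ _ => zero_le_one) _) hi] at h1
  filter_upwards [h1] with x hx hxN
  simp [hxN] at hx

theorem pi_unifBall_ac (d l : ℕ) (r : ℝ) (hr : 0 < r) :
    (Measure.pi fun _ : Fin l => unifBall d r) ≪ (volume : Measure (Fin l → Euc d)) := by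
  unfold unifBall
  have : IsFiniteMeasure (volume.restrict (Metric.ball (0 : Euc d) r)) :=
    isFiniteMeasure_restrict.2 (vol_ball_ne_top d r)
  rw [pi_smul_meas _ _ (ENNReal.inv_ne_top.2 (vol_ball_ne_zero d r hr)), ← Measure.restrict_pi_pi]
  exact (Measure.smul_absolutelyContinuous).trans
    (Measure.absolutelyContinuous_of_le Measure.restrict_le_self)

theorem withZero_succ {d l : ℕ} (z : Fin l → Euc d) (i : Fin l) : withZero z i.succ = z i := rfl
theorem withZero_zero {d l : ℕ} (z : Fin l → Euc d) : withZero z 0 = 0 := rfl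

/-- Difference of two coordinates as a linear map. -/
def diffMap (d l : ℕ) (i j : Fin (l + 1)) : (Fin l → Euc d) →ₗ[ℝ] Euc d where
  toFun z := withZero z i - withZero z j
  map_add' z z' := by
    have : ∀ k, withZero (z + z') k = withZero z k + withZero z' k := fun k => by
      refine Fin.cases ?_ (fun k => ?_) k
      · simp [withZero_zero]
      · simp [withZero_succ]
    rw [this, this]; abel
  map_smul' c z := by
    have : ∀ k, withZero (c • z) k = c • withZero z k := fun k => by
      refine Fin.cases ?_ (fun k => ?_) k
      · simp [withZero_zero]
      · simp [withZero_succ]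
    rw [this, this, ← smul_sub]; rfl

theorem diffMap_surj (d l : ℕ) {i j : Fin (l + 1)} (hij : i < j) : Function.Surjective (diffMap d l i j) := by
  intro x
  obtain ⟨j, rfl⟩ := Fin.exists_succ_eq.2 (ne_of_gt (lt_of_le_of_lt (Fin.zero_le i) hij))
  refine ⟨fun k => if k = j then -x else 0, ?_⟩
  show withZero _ i - withZero _ j.succ = x
  rw [withZero_succ]
  revert hij
  refine Fin.cases ?_ (fun i => ?_) i
  · intro _; simp [withZero_zero]
  · intro hij
    have : i ≠ j := by rintro rfl; exact lt_irrefl _ hij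
    simp [withZero_succ, this]

theorem dist_ae {d : ℕ} (hd : 1 ≤ d) (l : ℕ) {r : ℝ} (hr : 0 < r) {p : ℝ → Prop}
    (hp : ∀ᵐ t : ℝ, p t) {i j : Fin (l + 1)} (hij : i < j) :
    ∀ᵐ z ∂(Measure.pi fun _ : Fin l => unifBall d r), p (dist (withZero z i) (withZero z j)) := by
  refine (pi_unifBall_ac d l r hr).ae_le ?_
  have hN0 : volume (toMeasurable volume {t | ¬ p t}) = 0 := by
    rw [measure_toMeasurable]; exact hp
  have h1 := norm_ae hd (measurableSet_toMeasurable _ _) hN0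
  have hm : MeasurableSet {x : Euc d | ‖x‖ ∉ toMeasurable volume {t | ¬ p t}} :=
    (measurableSet_toMeasurable _ _).compl.preimage measurable_norm
  have h2 := (ae_comp_linearMap_mem_iff (diffMap d l i j) volume volume (diffMap_surj d l hij) hm).2 h1
  filter_upwards [h2] with z hz
  by_contra hc
  apply hz
  apply subset_toMeasurable
  show ¬ p ‖withZero z i - withZero z j‖
  rw [← dist_eq_norm_sub]
  exact hc

/-- Matrix of connection probabilities. -/
def pmat {d m : ℕ} (k : ℝ → ℝ → ℝ → ℝ) (z : Fin m → Euc d) (w : Fin m → ℝ) : Fin m → Fin m → ℝ :=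
  fun i j => k (dist (z i) (z j)) (w i) (w j)

/-- Averaged pattern probability. -/
def Psi (d : ℕ) (r : ℝ) {l : ℕ} (G : SimpleGraph (Fin (l + 1))) (k : ℝ → ℝ → ℝ → ℝ)
    (w : Fin (l + 1) → ℝ) : ℝ :=
  ∫ z, phi G (pmat k (withZero z) w) ∂(Measure.pi fun _ : Fin l => unifBall d r)

theorem measurable_withZero (d l : ℕ) : Measurable (withZero : (Fin l → Euc d) → _) := by
  refine measurable_pi_lambda _ fun i => ?_
  refine Fin.cases ?_ (fun i => ?_) i
  · simp only [withZero_zero]; exact measurable_const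
  · simp only [withZero_succ]; fun_prop

theorem measurable_phi_pmat {d m : ℕ} (G : SimpleGraph (Fin m)) {k : ℝ → ℝ → ℝ → ℝ}
    (hk : Measurable fun p : ℝ × ℝ × ℝ => k p.1 p.2.1 p.2.2) :
    Measurable (fun q : (Fin m → Euc d) × (Fin m → ℝ) => phi G (pmat k q.1 q.2)) := by
  refine (continuous_phi G).measurable.comp ?_
  refine measurable_pi_lambda _ fun i => measurable_pi_lambda _ fun j => ?_
  have : Measurable (fun q : (Fin m → Euc d) × (Fin m → ℝ) =>
    (dist (q.1 i) (q.1 j), q.2 i, q.2 j)) := by fun_prop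
  exact hk.comp this

theorem measurable_phi_z {d l : ℕ} (G : SimpleGraph (Fin (l + 1))) {k : ℝ → ℝ → ℝ → ℝ}
    (hk : Measurable fun p : ℝ × ℝ × ℝ => k p.1 p.2.1 p.2.2) :
    Measurable (fun q : (Fin (l + 1) → ℝ) × (Fin l → Euc d) => phi G (pmat k (withZero q.2) q.1)) := by
  have h1 : Measurable (fun q : (Fin (l + 1) → ℝ) × (Fin l → Euc d) => (withZero q.2, q.1)) :=
    ((measurable_withZero d l).comp measurable_snd).prodMk measurable_fst
  have h2 := (measurable_phi_pmat (d := d) G hk).comp h1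
  exact h2

theorem integrable_phi_z {d l : ℕ} {r : ℝ} (hr : 0 < r) (G : SimpleGraph (Fin (l + 1))) {k : ℝ → ℝ → ℝ → ℝ}
    (hk : Measurable fun p : ℝ × ℝ × ℝ => k p.1 p.2.1 p.2.2) (w : Fin (l + 1) → ℝ) :
    Integrable (fun z => phi G (pmat k (withZero z) w)) (Measure.pi fun _ : Fin l => unifBall d r) := by
  have := prob_unifBall d r hr
  refine Integrable.of_bound (C := 1) ?_ (Eventually.of_forall fun z => ?_)
  · exact ((measurable_phi_z G hk).comp (measurable_const.prodMk measurable_id)).aestronglyMeasurable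
  · rw [Real.norm_of_nonneg (phi_nonneg _ _)]; exact phi_le_one _ _

theorem Psi_nonneg (d : ℕ) (r : ℝ) {l : ℕ} (G : SimpleGraph (Fin (l + 1))) (k : ℝ → ℝ → ℝ → ℝ)
    (w : Fin (l + 1) → ℝ) : 0 ≤ Psi d r G k w := integral_nonneg fun _ => phi_nonneg _ _

theorem Psi_le_one (d : ℕ) {r : ℝ} (hr : 0 < r) {l : ℕ} (G : SimpleGraph (Fin (l + 1))) {k : ℝ → ℝ → ℝ → ℝ}
    (hk : Measurable fun p : ℝ × ℝ × ℝ => k p.1 p.2.1 p.2.2)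
    (w : Fin (l + 1) → ℝ) : Psi d r G k w ≤ 1 := by
  have := prob_unifBall d r hr
  calc Psi d r G k w ≤ ∫ z, (1 : ℝ) ∂(Measure.pi fun _ : Fin l => unifBall d r) :=
        integral_mono (integrable_phi_z hr G hk w) (integrable_const _) fun _ => phi_le_one _ _
    _ = 1 := by simp

theorem ofReal_Psi (d : ℕ) {r : ℝ} (hr : 0 < r) {l : ℕ} (G : SimpleGraph (Fin (l + 1))) {k : ℝ → ℝ → ℝ → ℝ}
    (hk : Measurable fun p : ℝ × ℝ × ℝ => k p.1 p.2.1 p.2.2) (w : Fin (l + 1) → ℝ) :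
    ENNReal.ofReal (Psi d r G k w) =
      ∫⁻ z, ENNReal.ofReal (phi G (pmat k (withZero z) w)) ∂(Measure.pi fun _ : Fin l => unifBall d r) :=
  ofReal_integral_eq_lintegral_ofReal (integrable_phi_z hr G hk w) (Eventually.of_forall fun _ => phi_nonneg _ _)

theorem measurable_Psi (d : ℕ) {r : ℝ} (hr : 0 < r) {l : ℕ} (G : SimpleGraph (Fin (l + 1))) {k : ℝ → ℝ → ℝ → ℝ}
    (hk : Measurable fun p : ℝ × ℝ × ℝ => k p.1 p.2.1 p.2.2) : Measurable (Psi d r G k) := by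
  have := prob_unifBall d r hr
  exact ((measurable_phi_z G hk).stronglyMeasurable.integral_prod_right').measurable

/-- Continuous convergence of the pattern probabilities. -/
theorem Psi_conv {d : ℕ} (hd : 1 ≤ d) {r : ℝ} (hr : 0 < r) {l : ℕ} (G : SimpleGraph (Fin (l + 1)))
    (kn : ℕ → ℝ → ℝ → ℝ → ℝ) (k : ℝ → ℝ → ℝ → ℝ)
    (hkn : ∀ n, Measurable fun p : ℝ × ℝ × ℝ => kn n p.1 p.2.1 p.2.2)
    (hc : ∀ (x y : ℝ) (xs ys : ℕ → ℝ),
      Tendsto xs atTop (𝓝 x) → Tendsto ys atTop (𝓝 y) →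
      ∀ᵐ t ∂(volume : Measure ℝ), 0 < t →
        Tendsto (fun n => kn n t (xs n) (ys n)) atTop (𝓝 (k t x y)))
    (ws : ℕ → Fin (l + 1) → ℝ) (w : Fin (l + 1) → ℝ) (hw : Tendsto ws atTop (𝓝 w)) :
    Tendsto (fun n => Psi d r G (kn n) (ws n)) atTop (𝓝 (Psi d r G k w)) := by
  have := prob_unifBall d r hr
  refine tendsto_integral_of_dominated_convergence (fun _ => (1 : ℝ))
    (fun n => (integrable_phi_z hr G (hkn n) (ws n)).1) (integrable_const _)
    (fun n => Eventually.of_forall fun z => ?_) ?_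
  · rw [Real.norm_of_nonneg (phi_nonneg _ _)]; exact phi_le_one _ _
  · have hz0 : ∀ᵐ t : ℝ, t ≠ 0 := by simp [ae_iff]
    have key : ∀ᵐ z ∂(Measure.pi fun _ : Fin l => unifBall d r),
        ∀ e : {e : Fin (l + 1) × Fin (l + 1) // e.1 < e.2},
        Tendsto (fun n => pmat (kn n) (withZero z) (ws n) e.1.1 e.1.2) atTop
          (𝓝 (pmat k (withZero z) w e.1.1 e.1.2)) := by
      rw [ae_all_iff]
      intro e
      have h1 := hc (w e.1.1) (w e.1.2) (fun n => ws n e.1.1) (fun n => ws n e.1.2)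
        (tendsto_pi_nhds.1 hw _) (tendsto_pi_nhds.1 hw _)
      filter_upwards [dist_ae hd l hr (h1.and hz0) e.2] with z hz
      exact hz.1 (lt_of_le_of_ne dist_nonneg (Ne.symm hz.2))
    filter_upwards [key] with z hz
    unfold phi
    exact tendsto_finsetProd _ fun e _ => ((continuous_efac _).tendsto _).comp (hz e)

theorem tim_pi {Ω : Type*} [MeasurableSpace Ω] (P : Measure Ω) {ι : Type*} [Fintype ι]
    {X : ℕ → Ω → ι → ℝ} {c : ι → ℝ}
    (h : ∀ i, TendstoInMeasure P (fun n ω => X n ω i) atTop (fun _ => c i)) :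
    TendstoInMeasure P X atTop (fun _ => c) := by
  intro ε hε
  have h1 : Tendsto (fun n => ∑ i, P {ω | ε ≤ edist (X n ω i) (c i)}) atTop (𝓝 0) := by
    have := tendsto_finsetSum (Finset.univ : Finset ι) (fun i _ => h i ε hε)
    simpa using this
  refine tendsto_of_tendsto_of_tendsto_of_le_of_le tendsto_const_nhds h1 (fun _ => zero_le) fun n => ?_
  refine (measure_mono ?_).trans (measure_iUnion_fintype_le P _)
  intro ω hω
  rw [Set.mem_iUnion]
  by_contra hc
  simp only [Set.mem_ofPred_eq, not_exists, not_le] at hc hω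
  rw [edist_pi_def] at hω
  exact absurd hω (not_le.2 ((Finset.sup_lt_iff hε).2 fun i _ => hc i))

theorem integral_tim {Ω : Type*} [MeasurableSpace Ω] (P : Measure Ω) [IsProbabilityMeasure P]
    {ι : Type*} [Fintype ι] {X : ℕ → Ω → ι → ℝ} {c : ι → ℝ} (hX : ∀ n, Measurable (X n))
    (h : ∀ i, TendstoInMeasure P (fun n ω => X n ω i) atTop (fun _ => c i))
    (Φ : (ι → ℝ) → ℝ) (hΦ : Continuous Φ) (C : ℝ) (hC : ∀ n ω, ‖Φ (X n ω)‖ ≤ C) :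
    Tendsto (fun n => ∫ ω, Φ (X n ω) ∂P) atTop (𝓝 (Φ c)) := by
  refine tendsto_of_subseq_tendsto fun ns hns => ?_
  obtain ⟨ms, _, hms⟩ := ((tim_pi P h).comp hns).exists_seq_tendsto_ae
  refine ⟨ms, ?_⟩
  have : Φ c = ∫ _, Φ c ∂P := by simp
  rw [this]
  refine tendsto_integral_of_dominated_convergence (fun _ => C)
    (fun n => (hΦ.measurable.comp (hX _)).aestronglyMeasurable) (integrable_const _)
    (fun n => Eventually.of_forall fun ω => hC _ ω) ?_
  filter_upwards [hms] with ω hω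
  exact (hΦ.tendsto c).comp hω

/-- Law of the weights at `m` uniformly chosen vertices. -/
def nuM {Ω : Type*} [MeasurableSpace Ω] (P : Measure Ω) {n : ℕ} (W : Fin n → Ω → ℝ) (m : ℕ) :
    Measure (Fin m → ℝ) :=
  ((n : ℝ≥0∞) ^ m)⁻¹ • ∑ v : Fin m → Fin n, P.map (fun ω i => W (v i) ω)

theorem prob_nuM {Ω : Type*} [MeasurableSpace Ω] (P : Measure Ω) [IsProbabilityMeasure P] {n : ℕ}
    (hn : 1 ≤ n) (W : Fin n → Ω → ℝ) (hW : ∀ i, Measurable (W i)) (m : ℕ) :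
    IsProbabilityMeasure (nuM P W m) := by
  constructor
  rw [nuM, Measure.smul_apply, Measure.finsetSum_apply]
  have : ∀ v : Fin m → Fin n, (P.map (fun ω i => W (v i) ω)) Set.univ = 1 := fun v => by
    rw [Measure.map_apply (by fun_prop) MeasurableSet.univ]; simp
  simp only [this]
  simp only [Finset.sum_const, Finset.card_univ, Fintype.card_fun, Fintype.card_fin, nsmul_eq_mul,
    mul_one, smul_eq_mul, Nat.cast_pow]
  refine ENNReal.inv_mul_cancel ?_ (by finiteness)
  simp; omega

theorem lintegral_nuM {Ω : Type*} [MeasurableSpace Ω] (P : Measure Ω) {n : ℕ}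
    (W : Fin n → Ω → ℝ) (hW : ∀ i, Measurable (W i)) (m : ℕ) (f : (Fin m → ℝ) → ℝ≥0∞) (hf : Measurable f) :
    ∫⁻ w, f w ∂(nuM P W m) = ((n : ℝ≥0∞) ^ m)⁻¹ * ∑ v : Fin m → Fin n, ∫⁻ ω, f (fun i => W (v i) ω) ∂P := by
  rw [nuM, lintegral_smul_measure, lintegral_finsetSum_measure, smul_eq_mul]
  congr 1
  refine Finset.sum_congr rfl fun v _ => ?_
  rw [lintegral_map hf (by fun_prop)]

theorem measurable_indic {Ω : Type*} [MeasurableSpace Ω] {p : Ω → Prop} (hp : MeasurableSet {ω | p ω}) :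
    Measurable fun ω => indic (p ω) := by
  classical
  exact Measurable.ite hp measurable_const measurable_const

theorem nuM_rect {Ω : Type*} [MeasurableSpace Ω] (P : Measure Ω) [IsProbabilityMeasure P] {n : ℕ}
    (W : Fin n → Ω → ℝ) (hW : ∀ i, Measurable (W i)) (m : ℕ) (a b : Fin m → ℝ) (hab : ∀ i, a i ≤ b i) :
    (nuM P W m).real (Set.pi Set.univ fun i => Set.Ioc (a i) (b i)) =
    ∫ ω, ∏ i, ((∑ j, indic (W j ω ≤ b i)) / n - (∑ j, indic (W j ω ≤ a i)) / n) ∂P := by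
  classical
  have hrm : MeasurableSet (Set.pi Set.univ fun i => Set.Ioc (a i) (b i)) :=
    MeasurableSet.univ_pi fun _ => measurableSet_Ioc
  have e1 : ∀ ω, ∏ i, ((∑ j, indic (W j ω ≤ b i)) / n - (∑ j, indic (W j ω ≤ a i)) / n) =
      ((n : ℝ) ^ m)⁻¹ * ∑ v : Fin m → Fin n,
        ((fun ω i => W (v i) ω) ⁻¹' (Set.pi Set.univ fun i => Set.Ioc (a i) (b i))).indicator 1 ω := by
    intro ω
    have : ∀ i, (∑ j, indic (W j ω ≤ b i)) / n - (∑ j, indic (W j ω ≤ a i)) / n =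
        (n : ℝ)⁻¹ * ∑ j, (if W j ω ∈ Set.Ioc (a i) (b i) then (1 : ℝ) else 0) := by
      intro i
      rw [← sub_div, ← Finset.sum_sub_distrib, div_eq_inv_mul]
      congr 1
      refine Finset.sum_congr rfl fun j _ => ?_
      have := hab i
      simp only [indic, Set.mem_Ioc]
      by_cases h1 : W j ω ≤ a i
      · simp [h1, h1.trans this, not_lt.2 h1]
      · simp [h1, not_le.1 h1]
    simp only [this]
    rw [Finset.prod_mul_distrib, Finset.prod_const, Finset.card_univ, Fintype.card_fin, inv_pow,
      Finset.prod_univ_sum, Fintype.piFinset_univ]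
    congr 1
    refine Finset.sum_congr rfl fun v _ => ?_
    rw [Finset.prod_ite_zero]
    simp [Set.indicator, Set.mem_pi]
  simp only [e1]
  rw [integral_const_mul, integral_finsetSum]
  · rw [measureReal_def, nuM, Measure.smul_apply, Measure.finsetSum_apply, smul_eq_mul, ENNReal.toReal_mul,
      ENNReal.toReal_sum]
    · congr 1
      · simp
      · refine Finset.sum_congr rfl fun v _ => ?_
        rw [integral_indicator_one (hrm.preimage (by fun_prop)), measureReal_def,
          Measure.map_apply (by fun_prop) hrm]
    · intro v _
      rw [Measure.map_apply (by fun_prop) hrm]; finiteness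
  · intro v _
    exact (integrable_const (1 : ℝ)).indicator (hrm.preimage (by fun_prop))

theorem emp_mem {n : ℕ} (p : Fin n → Prop) : 0 ≤ (∑ j, indic (p j)) / (n : ℝ) ∧ (∑ j, indic (p j)) / (n : ℝ) ≤ 1 := by
  have h0 : ∀ j, 0 ≤ indic (p j) := fun j => by unfold indic; split_ifs <;> simp
  have h1 : ∀ j, indic (p j) ≤ 1 := fun j => by unfold indic; split_ifs <;> simp
  refine ⟨div_nonneg (Finset.sum_nonneg fun j _ => h0 j) (Nat.cast_nonneg _), ?_⟩
  refine div_le_one_of_le₀ ?_ (Nat.cast_nonneg _)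
  calc ∑ j, indic (p j) ≤ ∑ j : Fin n, (1 : ℝ) := Finset.sum_le_sum fun j _ => h1 j
    _ = n := by simp

theorem exists_nonatom (μ : Measure ℝ) [IsProbabilityMeasure μ] {a b : ℝ} (h : a < b) :
    ∃ c, μ {c} = 0 ∧ a < c ∧ c < b := by
  have hc : Set.Countable {x : ℝ | 0 < μ {x}} := by
    refine Measure.countable_meas_pos_of_disjoint_iUnion (fun x => measurableSet_singleton x) ?_
    intro x y hxy
    simpa [Function.onFun] using hxy
  obtain ⟨c, hc1, hc2⟩ := (hc.dense_compl ℝ).exists_between h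
  exact ⟨c, by simpa using hc1, hc2⟩

/-- Bundle a probability measure. -/
def toPM {X : Type*} [MeasurableSpace X] (μ : Measure X) (h : IsProbabilityMeasure μ) :
    ProbabilityMeasure X := ⟨μ, h⟩

theorem nuM_weak {Ω : Type*} [MeasurableSpace Ω] (P : Measure Ω) [IsProbabilityMeasure P]
    (W : ∀ n, Fin n → Ω → ℝ) (hW : ∀ n i, Measurable (W n i)) (μW : Measure ℝ) [IsProbabilityMeasure μW]
    (hconv : ∀ x : ℝ, μW {x} = 0 → TendstoInMeasure P
      (fun n ω => (∑ i : Fin n, indic (W n i ω ≤ x)) / n) atTop (fun _ => (μW (Set.Iic x)).toReal))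
    (m : ℕ) :
    Tendsto (fun n : ℕ => toPM (nuM P (W (n + 1)) m) (prob_nuM P (Nat.le_add_left 1 n) _ (hW _) m)) atTop
      (𝓝 (toPM (Measure.pi fun _ : Fin m => μW) inferInstance)) := by
  let S : Set (Set (Fin m → ℝ)) := {t | ∃ a b : Fin m → ℝ, (∀ i, a i ≤ b i) ∧ (∀ i, μW {a i} = 0) ∧
    (∀ i, μW {b i} = 0) ∧ t = Set.pi Set.univ fun i => Set.Ioc (a i) (b i)}
  have hS : IsPiSystem S := by
    rintro - ⟨a, b, hab, ha, hb, rfl⟩ - ⟨a', b', hab', ha', hb', rfl⟩ ⟨x, hx, hx'⟩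
    refine ⟨fun i => max (a i) (a' i), fun i => min (b i) (b' i), fun i => ?_, fun i => ?_, fun i => ?_, ?_⟩
    · have h1 := hx i (Set.mem_univ i)
      have h2 := hx' i (Set.mem_univ i)
      exact (max_le h1.1.le h2.1.le).trans (le_min h1.2 h2.2)
    · rcases max_choice (a i) (a' i) with h | h <;> simp only [h, ha, ha']
    · rcases min_choice (b i) (b' i) with h | h <;> simp only [h, hb, hb']
    · rw [← Set.pi_inter_distrib]
      simp only [Set.Ioc_inter_Ioc]
  refine hS.tendsto_probabilityMeasure_of_tendsto_of_mem ?_ ?_ ?_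
  · rintro s ⟨a, b, _, _, _, rfl⟩
    exact MeasurableSet.univ_pi fun _ => measurableSet_Ioc
  · intro u hu x hxu
    obtain ⟨ε, hε, hball⟩ := Metric.isOpen_iff.1 hu x hxu
    have h1 : ∀ i, ∃ c, μW {c} = 0 ∧ x i - ε < c ∧ c < x i := fun i => exists_nonatom μW (by linarith)
    have h2 : ∀ i, ∃ c, μW {c} = 0 ∧ x i < c ∧ c < x i + ε := fun i => exists_nonatom μW (by linarith)
    choose a ha0 ha1 ha2 using h1
    choose b hb0 hb1 hb2 using h2
    refine ⟨_, ⟨a, b, fun i => ((ha2 i).trans (hb1 i)).le, ha0, hb0, rfl⟩, ?_, ?_⟩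
    · exact set_pi_mem_nhds Set.finite_univ fun i _ => Ioc_mem_nhds (ha2 i) (hb1 i)
    · intro y hy
      apply hball
      rw [Metric.mem_ball, dist_pi_lt_iff hε]
      intro i
      have := hy i (Set.mem_univ i)
      rw [Real.dist_eq, abs_lt]
      have := ha1 i; have := hb2 i
      constructor <;> linarith [this, (hy i (Set.mem_univ i)).1, (hy i (Set.mem_univ i)).2]
  · rintro s ⟨a, b, hab, ha, hb, rfl⟩
    rw [← NNReal.tendsto_coe]
    show Tendsto (fun n : ℕ => (nuM P (W (n + 1)) m).real _) atTop (𝓝 ((Measure.pi fun _ : Fin m => μW).real _))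
    have e : (Measure.pi fun _ : Fin m => μW).real (Set.pi Set.univ fun i => Set.Ioc (a i) (b i)) =
        ∏ i, ((μW (Set.Iic (b i))).toReal - (μW (Set.Iic (a i))).toReal) := by
      rw [measureReal_def, Measure.pi_pi, ENNReal.toReal_prod]
      refine Finset.prod_congr rfl fun i _ => ?_
      have : Set.Ioc (a i) (b i) = Set.Iic (b i) \ Set.Iic (a i) := by ext; simp [and_comm]
      rw [this, measure_sdiff (Set.Iic_subset_Iic.2 (hab i)) measurableSet_Iic.nullMeasurableSet (by finiteness),
        ENNReal.toReal_sub_of_le (measure_mono (Set.Iic_subset_Iic.2 (hab i))) (by finiteness)]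
    rw [e]
    have e2 : ∀ n : ℕ, (nuM P (W n) m).real (Set.pi Set.univ fun i => Set.Ioc (a i) (b i)) = _ :=
      fun n => nuM_rect P (W n) (hW n) m a b hab
    simp only [e2]
    let X : ℕ → Ω → (Fin m ⊕ Fin m → ℝ) := fun n ω => Sum.elim
      (fun i => (∑ j : Fin n, indic (W n j ω ≤ b i)) / n) (fun i => (∑ j : Fin n, indic (W n j ω ≤ a i)) / n)
    let c : Fin m ⊕ Fin m → ℝ := Sum.elim (fun i => (μW (Set.Iic (b i))).toReal) (fun i => (μW (Set.Iic (a i))).toReal)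
    have hX : ∀ n, Measurable (X n) := by
      intro n
      refine measurable_pi_lambda _ fun i => ?_
      rcases i with i | i
      · exact (Finset.measurable_fun_sum _ fun j _ => measurable_indic (measurableSet_le (hW n j) measurable_const)).div_const _
      · exact (Finset.measurable_fun_sum _ fun j _ => measurable_indic (measurableSet_le (hW n j) measurable_const)).div_const _
    have key := integral_tim P (X := X) (c := c) hX
      (by rintro (i | i); exacts [hconv _ (hb i), hconv _ (ha i)])
      (fun x => ∏ i, (x (Sum.inl i) - x (Sum.inr i))) (by fun_prop) 1
      (by
        intro n ω
        rw [norm_prod]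
        refine Finset.prod_le_one (fun _ _ => norm_nonneg _) fun i _ => ?_
        have h1 := emp_mem (fun j => W n j ω ≤ b i)
        have h2 := emp_mem (fun j => W n j ω ≤ a i)
        rw [Real.norm_eq_abs, abs_le]
        simp only [X, Sum.elim_inl, Sum.elim_inr]
        constructor <;> linarith)
    exact (tendsto_add_atTop_iff_nat 1).2 key

theorem joint_of_cc {E : Type*} [TopologicalSpace E] [FirstCountableTopology E]
    {f : ℕ → E → ℝ} {g : E → ℝ}
    (hcc : ∀ (xs : ℕ → E) (x : E), Tendsto xs atTop (𝓝 x) → Tendsto (fun n => f n (xs n)) atTop (𝓝 (g x)))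
    (x : E) : Tendsto (fun p : ℕ × E => f p.1 p.2) (atTop ×ˢ 𝓝 x) (𝓝 (g x)) := by
  refine tendsto_of_seq_tendsto fun s hs => ?_
  have h1 : Tendsto (fun k => (s k).1) atTop atTop := tendsto_fst.comp hs
  have h2 : Tendsto (fun k => (s k).2) atTop (𝓝 x) := tendsto_snd.comp hs
  refine tendsto_of_subseq_tendsto fun ns hns => ?_
  obtain ⟨φ, hφ, hφ'⟩ := strictMono_subseq_of_tendsto_atTop (h1.comp hns)
  refine ⟨φ, ?_⟩
  set a : ℕ → ℕ := (fun k => (s (ns (φ k))).1) with ha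
  set b : ℕ → E := (fun k => (s (ns (φ k))).2) with hb
  have ham : StrictMono a := hφ'
  have hbt : Tendsto b atTop (𝓝 x) := h2.comp (hns.comp hφ.tendsto_atTop)
  have hext : Tendsto (Function.extend a b (fun _ => x)) atTop (𝓝 x) := by
    intro U hU
    obtain ⟨K, hK⟩ := eventually_atTop.1 (hbt.eventually hU)
    refine mem_map.2 (mem_atTop_sets.2 ⟨a K, fun n hn => ?_⟩)
    show Function.extend a b (fun _ => x) n ∈ U
    by_cases he : ∃ k, a k = n
    · obtain ⟨k, rfl⟩ := he
      rw [ham.injective.extend_apply]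
      exact hK k (ham.le_iff_le.1 hn)
    · rw [Function.extend_apply' _ _ _ he]
      exact mem_of_mem_nhds hU
  have h3 := (hcc _ x hext).comp ham.tendsto_atTop
  refine h3.congr fun k => ?_
  simp only [Function.comp_apply, ham.injective.extend_apply]
  rfl

theorem cc_loc {E : Type*} [TopologicalSpace E] [FirstCountableTopology E]
    {f : ℕ → E → ℝ} {g : E → ℝ}
    (hcc : ∀ (xs : ℕ → E) (x : E), Tendsto xs atTop (𝓝 x) → Tendsto (fun n => f n (xs n)) atTop (𝓝 (g x)))
    (x : E) {ε : ℝ} (hε : 0 < ε) :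
    ∃ t ∈ 𝓝 x, (∀ᶠ n in atTop, ∀ y ∈ t, |f n y - g x| < ε) ∧ ∀ y ∈ t, |g y - g x| ≤ ε := by
  have h := (joint_of_cc hcc x).eventually (Metric.ball_mem_nhds _ hε)
  rw [eventually_prod_iff] at h
  obtain ⟨pa, hpa, pb, hpb, h⟩ := h
  refine ⟨{y | pb y}, hpb, hpa.mono fun n hn y hy => ?_, fun y hy => ?_⟩
  · have := h hn hy
    rwa [Real.dist_eq] at this
  · have h1 : Tendsto (fun n => |f n y - g x|) atTop (𝓝 |g y - g x|) :=
      ((hcc (fun _ => y) y tendsto_const_nhds).sub_const _).abs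
    refine le_of_tendsto h1 (hpa.mono fun n hn => ?_)
    have := h hn hy
    rw [Real.dist_eq] at this
    exact this.le

theorem cc_cont {E : Type*} [TopologicalSpace E] [FirstCountableTopology E]
    {f : ℕ → E → ℝ} {g : E → ℝ}
    (hcc : ∀ (xs : ℕ → E) (x : E), Tendsto xs atTop (𝓝 x) → Tendsto (fun n => f n (xs n)) atTop (𝓝 (g x))) :
    Continuous g := by
  rw [continuous_iff_continuousAt]
  intro x
  rw [ContinuousAt, Metric.tendsto_nhds]
  intro ε hε
  obtain ⟨t, ht, -, h⟩ := cc_loc hcc x (half_pos hε)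
  filter_upwards [ht] with y hy
  rw [Real.dist_eq]
  linarith [h y hy]

theorem cc_unif {E : Type*} [TopologicalSpace E] [FirstCountableTopology E]
    {f : ℕ → E → ℝ} {g : E → ℝ}
    (hcc : ∀ (xs : ℕ → E) (x : E), Tendsto xs atTop (𝓝 x) → Tendsto (fun n => f n (xs n)) atTop (𝓝 (g x)))
    {K : Set E} (hK : IsCompact K) {ε : ℝ} (hε : 0 < ε) :
    ∀ᶠ n in atTop, ∀ y ∈ K, |f n y - g y| < ε := by
  refine hK.induction_on (p := fun K => ∀ᶠ n in atTop, ∀ y ∈ K, |f n y - g y| < ε) ?_ ?_ ?_ ?_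
  · simp
  · intro s t hst h
    exact h.mono fun n hn y hy => hn y (hst hy)
  · intro s t hs ht
    filter_upwards [hs, ht] with n h1 h2 y hy
    exact hy.elim (h1 y) (h2 y)
  · intro x _
    obtain ⟨t, ht, h1, h2⟩ := cc_loc hcc x (half_pos hε)
    refine ⟨t, mem_nhdsWithin_of_mem_nhds ht, h1.mono fun n hn y hy => ?_⟩
    have a := abs_lt.1 (hn y hy)
    have b := abs_le.1 (h2 y hy)
    rw [abs_lt]
    constructor <;> linarith

theorem ext_cmt {m : ℕ} {f : ℕ → (Fin m → ℝ) → ℝ} {g : (Fin m → ℝ) → ℝ}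
    (hcc : ∀ (xs : ℕ → Fin m → ℝ) (x : Fin m → ℝ), Tendsto xs atTop (𝓝 x) →
      Tendsto (fun n => f n (xs n)) atTop (𝓝 (g x)))
    (hf : ∀ n, Measurable (f n)) (hf0 : ∀ n x, 0 ≤ f n x) (hf1 : ∀ n x, f n x ≤ 1)
    {ν : ℕ → ProbabilityMeasure (Fin m → ℝ)} {ν' : ProbabilityMeasure (Fin m → ℝ)}
    (hν : Tendsto ν atTop (𝓝 ν')) :
    Tendsto (fun n => ∫ x, f n x ∂(ν n : Measure (Fin m → ℝ))) atTop
      (𝓝 (∫ x, g x ∂(ν' : Measure (Fin m → ℝ)))) := by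
  have hg := cc_cont hcc
  have hgl : ∀ x, Tendsto (fun n => f n x) atTop (𝓝 (g x)) := fun x => hcc _ x tendsto_const_nhds
  have hg0 : ∀ x, 0 ≤ g x := fun x => ge_of_tendsto' (hgl x) fun n => hf0 n x
  have hg1 : ∀ x, g x ≤ 1 := fun x => le_of_tendsto' (hgl x) fun n => hf1 n x
  have bdd : ∀ h : (Fin m → ℝ) → ℝ, Continuous h → (∀ x, 0 ≤ h x) → (∀ x, h x ≤ 1) →
      Tendsto (fun n => ∫ x, h x ∂(ν n : Measure (Fin m → ℝ))) atTop
      (𝓝 (∫ x, h x ∂(ν' : Measure (Fin m → ℝ)))) := by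
    intro h hc h0 h1
    exact ProbabilityMeasure.tendsto_iff_forall_integral_tendsto.1 hν
      (BoundedContinuousFunction.ofNormedAddCommGroup h hc 1 fun x => by
        rw [Real.norm_of_nonneg (h0 x)]; exact h1 x)
  have hIntb : ∀ (μ : ProbabilityMeasure (Fin m → ℝ)) (h : (Fin m → ℝ) → ℝ), Measurable h →
      (∀ x, 0 ≤ h x) → (∀ x, h x ≤ 1) → Integrable h (μ : Measure (Fin m → ℝ)) := by
    intro μ h hm h0 h1
    exact Integrable.of_bound (C := 1) hm.aestronglyMeasurable
      (Eventually.of_forall fun x => by rw [Real.norm_of_nonneg (h0 x)]; exact h1 x)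
  let χ : ℕ → (Fin m → ℝ) → ℝ := fun R x => 1 - max 0 (min 1 ((R : ℝ) + 1 - ‖x‖))
  have χc : ∀ R, Continuous (χ R) := fun R => by simp only [χ]; fun_prop
  have χ0 : ∀ R x, 0 ≤ χ R x := fun R x => by
    simp only [χ, sub_nonneg]; exact max_le zero_le_one (min_le_left _ _)
  have χ1 : ∀ R x, χ R x ≤ 1 := fun R x => by
    simp only [χ]; linarith [le_max_left 0 (min 1 ((R : ℝ) + 1 - ‖x‖))]
  have χlim : Tendsto (fun R => ∫ x, χ R x ∂(ν' : Measure (Fin m → ℝ))) atTop (𝓝 0) := by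
    have : (0 : ℝ) = ∫ x, (0 : ℝ) ∂(ν' : Measure (Fin m → ℝ)) := by simp
    rw [this]
    refine tendsto_integral_of_dominated_convergence (fun _ => 1)
      (fun R => (χc R).aestronglyMeasurable) (integrable_const _)
      (fun R => Eventually.of_forall fun x => by rw [Real.norm_of_nonneg (χ0 R x)]; exact χ1 R x)
      (Eventually.of_forall fun x => ?_)
    refine tendsto_const_nhds.congr' ?_
    filter_upwards [eventually_ge_atTop ⌈‖x‖⌉₊] with R hR
    have h1 : ‖x‖ ≤ R := (Nat.le_ceil _).trans (by exact_mod_cast hR)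
    simp only [χ]
    rw [min_eq_left (by linarith), max_eq_right zero_le_one, sub_self]
  have first : Tendsto (fun n => ∫ x, (f n x - g x) ∂(ν n : Measure (Fin m → ℝ))) atTop (𝓝 0) := by
    rw [Metric.tendsto_nhds]
    intro ε hε
    obtain ⟨R, hR⟩ := (χlim.eventually (gt_mem_nhds (show (0 : ℝ) < ε / 2 by positivity))).exists
    have h1 := (bdd (χ R) (χc R) (χ0 R) (χ1 R)).eventually (gt_mem_nhds hR)
    have h2 := cc_unif hcc (isCompact_closedBall (0 : Fin m → ℝ) ((R : ℝ) + 1)) (half_pos hε)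
    filter_upwards [h1, h2] with n h1 h2
    have hpt : ∀ x, |f n x - g x| ≤ ε / 2 + χ R x := by
      intro x
      by_cases hx : x ∈ Metric.closedBall (0 : Fin m → ℝ) ((R : ℝ) + 1)
      · linarith [h2 x hx, χ0 R x]
      · have : χ R x = 1 := by
          simp only [Metric.mem_closedBall, dist_zero_right, not_le] at hx
          simp only [χ]
          rw [min_eq_right (by linarith), max_eq_left (by linarith), sub_zero]
        rw [this, abs_le]
        have := hf0 n x; have := hf1 n x; have := hg0 x; have := hg1 x
        constructor <;> linarith
    rw [Real.dist_eq, sub_zero]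
    calc |∫ x, (f n x - g x) ∂(ν n : Measure (Fin m → ℝ))|
        ≤ ∫ x, |f n x - g x| ∂(ν n : Measure (Fin m → ℝ)) := abs_integral_le_integral_abs
      _ ≤ ∫ x, (ε / 2 + χ R x) ∂(ν n : Measure (Fin m → ℝ)) := by
          refine integral_mono ?_ ?_ hpt
          · exact ((hIntb _ _ (hf n) (hf0 n) (hf1 n)).sub (hIntb _ _ hg.measurable hg0 hg1)).abs
          · exact (integrable_const _).add (hIntb _ _ (χc R).measurable (χ0 R) (χ1 R))
      _ = ε / 2 + ∫ x, χ R x ∂(ν n : Measure (Fin m → ℝ)) := by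
          rw [integral_add (integrable_const _) (hIntb _ _ (χc R).measurable (χ0 R) (χ1 R))]
          simp
      _ < ε := by linarith
  have := first.add (bdd g hg hg0 hg1)
  rw [zero_add] at this
  refine this.congr fun n => ?_
  rw [integral_sub (hIntb _ _ (hf n) (hf0 n) (hf1 n)) (hIntb _ _ hg.measurable hg0 hg1)]
  ring

theorem ext_cmt_lintegral {m : ℕ} {f : ℕ → (Fin m → ℝ) → ℝ} {g : (Fin m → ℝ) → ℝ}
    (hcc : ∀ (xs : ℕ → Fin m → ℝ) (x : Fin m → ℝ), Tendsto xs atTop (𝓝 x) →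
      Tendsto (fun n => f n (xs n)) atTop (𝓝 (g x)))
    (hf : ∀ n, Measurable (f n)) (hf0 : ∀ n x, 0 ≤ f n x) (hf1 : ∀ n x, f n x ≤ 1)
    {ν : ℕ → ProbabilityMeasure (Fin m → ℝ)} {ν' : ProbabilityMeasure (Fin m → ℝ)}
    (hν : Tendsto ν atTop (𝓝 ν')) :
    Tendsto (fun n => ∫⁻ x, ENNReal.ofReal (f n x) ∂(ν n : Measure (Fin m → ℝ))) atTop
      (𝓝 (∫⁻ x, ENNReal.ofReal (g x) ∂(ν' : Measure (Fin m → ℝ)))) := by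
  have hg := cc_cont hcc
  have hgl : ∀ x, Tendsto (fun n => f n x) atTop (𝓝 (g x)) := fun x => hcc _ x tendsto_const_nhds
  have hg0 : ∀ x, 0 ≤ g x := fun x => ge_of_tendsto' (hgl x) fun n => hf0 n x
  have hg1 : ∀ x, g x ≤ 1 := fun x => le_of_tendsto' (hgl x) fun n => hf1 n x
  have hIntb : ∀ (μ : ProbabilityMeasure (Fin m → ℝ)) (h : (Fin m → ℝ) → ℝ), Measurable h →
      (∀ x, 0 ≤ h x) → (∀ x, h x ≤ 1) → ENNReal.ofReal (∫ x, h x ∂(μ : Measure (Fin m → ℝ))) =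
        ∫⁻ x, ENNReal.ofReal (h x) ∂(μ : Measure (Fin m → ℝ)) := by
    intro μ h hm h0 h1
    refine ofReal_integral_eq_lintegral_ofReal ?_ (Eventually.of_forall h0)
    exact Integrable.of_bound (C := 1) hm.aestronglyMeasurable
      (Eventually.of_forall fun x => by rw [Real.norm_of_nonneg (h0 x)]; exact h1 x)
  rw [← hIntb ν' g hg.measurable hg0 hg1]
  refine (ENNReal.tendsto_ofReal (ext_cmt hcc hf hf0 hf1 hν)).congr fun n => ?_
  exact hIntb _ _ (hf n) (hf0 n) (hf1 n)

theorem inj_ratio (m : ℕ) :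
    Tendsto (fun n : ℕ => (((n + 1 : ℕ) : ℝ≥0∞) ^ m)⁻¹ * ((n + 1).descFactorial m : ℝ≥0∞)) atTop (𝓝 1) := by
  have h1 : Tendsto (fun n : ℕ => ((n.descFactorial m : ℝ)) / (n : ℝ) ^ m) atTop (𝓝 1) := by
    refine (Asymptotics.isEquivalent_iff_tendsto_one ?_).1 (isEquivalent_descFactorial m)
    filter_upwards [eventually_gt_atTop 0] with n hn
    positivity
  have h2 := ENNReal.tendsto_ofReal ((tendsto_add_atTop_iff_nat 1).2 h1)
  rw [ENNReal.ofReal_one] at h2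
  refine h2.congr fun n => ?_
  rw [ENNReal.ofReal_div_of_pos (by positivity), ENNReal.ofReal_natCast, ENNReal.ofReal_pow (by positivity),
    ENNReal.ofReal_natCast, div_eq_mul_inv, mul_comm]

open Classical in
theorem inj_sum {m : ℕ} (s : ∀ n : ℕ, (Fin m → Fin (n + 1)) → ℝ≥0∞) (hs : ∀ n v, s n v ≤ 1) {L : ℝ≥0∞}
    (h : Tendsto (fun n : ℕ => (((n + 1 : ℕ) : ℝ≥0∞) ^ m)⁻¹ * ∑ v, s n v) atTop (𝓝 L)) :
    Tendsto (fun n : ℕ => (((n + 1 : ℕ) : ℝ≥0∞) ^ m)⁻¹ *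
      ∑ v ∈ Finset.univ.filter Function.Injective, s n v) atTop (𝓝 L) := by
  have hc : Tendsto (fun n : ℕ => 1 - (((n + 1 : ℕ) : ℝ≥0∞) ^ m)⁻¹ * ((n + 1).descFactorial m : ℝ≥0∞))
      atTop (𝓝 0) := by
    have := ENNReal.Tendsto.sub (tendsto_const_nhds (x := (1 : ℝ≥0∞))) (inj_ratio m) (Or.inl (by simp))
    simpa using this
  have h1 := ENNReal.Tendsto.sub h hc (Or.inr (by simp))
  rw [tsub_zero] at h1
  refine tendsto_of_tendsto_of_tendsto_of_le_of_le h1 h (fun n => ?_) (fun n => ?_)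
  · have hN0 : ((n + 1 : ℕ) : ℝ≥0∞) ^ m ≠ 0 := by simp
    have hNt : ((n + 1 : ℕ) : ℝ≥0∞) ^ m ≠ ∞ := by finiteness
    have hcard : (Finset.univ.filter (Function.Injective : (Fin m → Fin (n + 1)) → Prop)).card =
        (n + 1).descFactorial m := by
      have := Fintype.card_embedding_eq (α := Fin m) (β := Fin (n + 1))
      rw [Fintype.card_fin, Fintype.card_fin] at this
      rw [← this, ← Fintype.card_subtype]
      exact Fintype.card_congr (Equiv.subtypeInjectiveEquivEmbedding _ _)
    have hsplit : ((Finset.univ.filter (Function.Injective : (Fin m → Fin (n + 1)) → Prop)).card : ℝ≥0∞) +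
        ((Finset.univ.filter (fun v : Fin m → Fin (n + 1) => ¬ Function.Injective v)).card : ℝ≥0∞) =
        ((n + 1 : ℕ) : ℝ≥0∞) ^ m := by
      rw [← Nat.cast_add, Finset.card_filter_add_card_filter_not]
      simp
    have e : 1 - (((n + 1 : ℕ) : ℝ≥0∞) ^ m)⁻¹ * ((n + 1).descFactorial m : ℝ≥0∞) =
        (((n + 1 : ℕ) : ℝ≥0∞) ^ m)⁻¹ *
          ((Finset.univ.filter (fun v : Fin m → Fin (n + 1) => ¬ Function.Injective v)).card : ℝ≥0∞) := by
      refine (ENNReal.eq_sub_of_add_eq (by finiteness) ?_).symm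
      rw [← mul_add, ← hcard, add_comm (Nat.cast _ : ℝ≥0∞), hsplit, ENNReal.inv_mul_cancel hN0 hNt]
    rw [e, tsub_le_iff_right, ← mul_add]
    gcongr
    rw [← Finset.sum_filter_add_sum_filter_not Finset.univ Function.Injective]
    gcongr
    calc _ ≤ ∑ v ∈ Finset.univ.filter (fun v : Fin m → Fin (n + 1) => ¬ Function.Injective v), (1 : ℝ≥0∞) :=
          Finset.sum_le_sum fun v _ => hs n v
      _ = _ := by simp
  · gcongr
    exact Finset.subset_univ _

open Classical in
/-- Convergence of the weight part. -/
theorem T_conv {d : ℕ} (hd : 1 ≤ d) {Ω : Type} [MeasurableSpace Ω] (M : SIRGModel d Ω)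
    (A : SIRGAssumptions M) {r : ℝ} (hr : 0 < r) {l : ℕ} (G : SimpleGraph (Fin (l + 1))) :
    Tendsto (fun n : ℕ => (((n + 1 : ℕ) : ℝ≥0∞) ^ (l + 1))⁻¹ *
      ∑ v ∈ Finset.univ.filter (Function.Injective : (Fin (l + 1) → Fin (n + 1)) → Prop),
        ∫⁻ ω, ENNReal.ofReal (Psi d r G (M.κn (n + 1)) (fun i => M.Wt (n + 1) (v i) ω)) ∂M.P) atTop
      (𝓝 (∫⁻ w, ENNReal.ofReal (Psi d r G A.κ w) ∂(Measure.pi fun _ : Fin (l + 1) => A.μW))) := by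
  have := A.probμW
  refine inj_sum (fun n v => ∫⁻ ω, ENNReal.ofReal (Psi d r G (M.κn (n + 1)) (fun i => M.Wt (n + 1) (v i) ω)) ∂M.P)
    (fun n v => ?_) ?_
  · calc _ ≤ ∫⁻ _, 1 ∂M.P := lintegral_mono fun ω =>
          ENNReal.ofReal_le_one.2 (Psi_le_one d hr G (M.κn_meas _) _)
      _ = 1 := by simp
  · have hw := nuM_weak M.P M.Wt M.Wt_meas A.μW A.weights_conv (l + 1)
    have key := ext_cmt_lintegral (f := fun n => Psi d r G (M.κn (n + 1))) (g := Psi d r G A.κ) ?_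
      (fun n => measurable_Psi d hr G (M.κn_meas _)) (fun n x => Psi_nonneg _ _ _ _ _)
      (fun n x => Psi_le_one d hr G (M.κn_meas _) x) hw
    · refine key.congr fun n => ?_
      exact lintegral_nuM M.P (M.Wt (n + 1)) (M.Wt_meas _) (l + 1) _
        (measurable_Psi d hr G (M.κn_meas _)).ennreal_ofReal
    · intro xs x hx
      refine Psi_conv hd hr G (fun n => M.κn (n + 1)) A.κ (fun n => M.κn_meas _) ?_ xs x hx
      intro x y xs ys hxs hys
      have := A.κ_conv x y (fun n => xs (n - 1)) (fun n => ys (n - 1))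
        (hxs.comp (tendsto_sub_atTop_nat 1)) (hys.comp (tendsto_sub_atTop_nat 1))
      filter_upwards [this] with t ht h0
      exact (ht h0).comp (tendsto_add_atTop_nat 1)

theorem measurableSet_iff' {X : Type*} [MeasurableSpace X] {p q : X → Prop} (hp : MeasurableSet {x | p x})
    (hq : MeasurableSet {x | q x}) : MeasurableSet {x | p x ↔ q x} := by
  have : {x | p x ↔ q x} = ({x | p x} ∩ {x | q x}) ∪ ({x | p x}ᶜ ∩ {x | q x}ᶜ) := by
    ext x
    simp only [Set.mem_ofPred_eq, Set.mem_union, Set.mem_inter_iff, Set.mem_compl_iff]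
    tauto
  rw [this]
  exact (hp.inter hq).union (hp.compl.inter hq.compl)

/-- Sorting a pair of distinct vertices. -/
def sortP {n m : ℕ} (v : Fin m → Fin n) (hv : Function.Injective v)
    (e : {e : Fin m × Fin m // e.1 < e.2}) : {e : Fin n × Fin n // e.1 < e.2} :=
  if h : v e.1.1 < v e.1.2 then ⟨(v e.1.1, v e.1.2), h⟩ else
    ⟨(v e.1.2, v e.1.1), lt_of_le_of_ne (not_lt.1 h) fun hh => e.2.ne (hv hh).symm⟩

theorem sortP_inj {n m : ℕ} (v : Fin m → Fin n) (hv : Function.Injective v) :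
    Function.Injective (sortP v hv) := by
  rintro ⟨⟨a, b⟩, hab⟩ ⟨⟨a', b'⟩, hab'⟩ h
  simp only at hab hab'
  unfold sortP at h
  simp only at h
  split_ifs at h with h1 h2 h2 <;> simp only [Subtype.mk.injEq, Prod.mk.injEq] at h
  · simp [hv h.1, hv h.2]
  · have e1 := hv h.1; have e2 := hv h.2
    subst e1 e2; exact absurd hab hab'.not_gt
  · have e1 := hv h.1; have e2 := hv h.2
    subst e1 e2; exact absurd hab hab'.not_gt
  · simp [hv h.1, hv h.2]

theorem gOf_adj_sort {d n m : ℕ} {k : ℝ → ℝ → ℝ → ℝ} (hk : ∀ t x y, k t x y = k t y x)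
    (y : Fin n → Euc d) (w : Fin n → ℝ) (u : Fin n → Fin n → ℝ)
    (v : Fin m → Fin n) (hv : Function.Injective v) (e : {e : Fin m × Fin m // e.1 < e.2}) :
    (gOf (pmat k y w) u).Adj (v e.1.1) (v e.1.2) ↔
      u (sortP v hv e).1.1 (sortP v hv e).1.2 ≤
        pmat k (fun i => y (v i)) (fun i => w (v i)) e.1.1 e.1.2 := by
  unfold sortP
  split_ifs with h
  · exact gOf_adj_lt _ _ h
  · have h' : v e.1.2 < v e.1.1 := lt_of_le_of_ne (not_lt.1 h) fun hh => e.2.ne (hv hh).symm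
    rw [SimpleGraph.adj_comm, gOf_adj_lt _ _ h']
    simp only [pmat]
    rw [hk, dist_comm]

theorem measurable_pmat {d n : ℕ} {k : ℝ → ℝ → ℝ → ℝ}
    (hk : Measurable fun p : ℝ × ℝ × ℝ => k p.1 p.2.1 p.2.2) {X : Type*} [MeasurableSpace X]
    {y : X → Fin n → Euc d} {w : X → Fin n → ℝ} (hy : Measurable y) (hw : Measurable w) (i j : Fin n) :
    Measurable fun x => pmat k (y x) (w x) i j := by
  have : Measurable (fun x => (dist (y x i) (y x j), w x i, w x j)) := by fun_prop
  exact hk.comp this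

/-- The event, in the space of all data, that `v` enumerates the neighbourhood of `v 0` with pattern `G`. -/
def evSet (d n : ℕ) (r : ℝ) {l : ℕ} (k : ℝ → ℝ → ℝ → ℝ) (v : Fin (l + 1) → Fin n)
    (G : SimpleGraph (Fin (l + 1))) : Set ((Fin n → Euc d) × (Fin n → ℝ) × (Fin n → Fin n → ℝ)) :=
  {q | q.1 ∈ goodSet d n r v ∧ (gOf (pmat k q.1 q.2.1) q.2.2).comap v = G}

theorem evSet_iff {d n : ℕ} {r : ℝ} {l : ℕ} {k : ℝ → ℝ → ℝ → ℝ} (hks : ∀ t x y, k t x y = k t y x)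
    {v : Fin (l + 1) → Fin n} (hv : Function.Injective v) (G : SimpleGraph (Fin (l + 1)))
    (q : (Fin n → Euc d) × (Fin n → ℝ) × (Fin n → Fin n → ℝ)) :
    q ∈ evSet d n r k v G ↔ q.1 ∈ goodSet d n r v ∧ ∀ e : {e : Fin (l + 1) × Fin (l + 1) // e.1 < e.2},
      (q.2.2 (sortP v hv e).1.1 (sortP v hv e).1.2 ≤
        pmat k (fun i => q.1 (v i)) (fun i => q.2.1 (v i)) e.1.1 e.1.2 ↔ G.Adj e.1.1 e.1.2) := by
  refine and_congr Iff.rfl ?_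
  rw [graph_eq_iff]
  refine forall_congr' fun e => ?_
  rw [SimpleGraph.comap_adj, gOf_adj_sort hks _ _ _ v hv e]

theorem measurableSet_evSet {d n : ℕ} {r : ℝ} {l : ℕ} {k : ℝ → ℝ → ℝ → ℝ} (hks : ∀ t x y, k t x y = k t y x)
    (hk : Measurable fun p : ℝ × ℝ × ℝ => k p.1 p.2.1 p.2.2)
    {v : Fin (l + 1) → Fin n} (hv : Function.Injective v) (G : SimpleGraph (Fin (l + 1))) :
    MeasurableSet (evSet d n r k v G) := by
  have : evSet d n r k v G = Prod.fst ⁻¹' (goodSet d n r v) ∩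
      ⋂ e : {e : Fin (l + 1) × Fin (l + 1) // e.1 < e.2}, {q | q.2.2 (sortP v hv e).1.1 (sortP v hv e).1.2 ≤
        pmat k (fun i => q.1 (v i)) (fun i => q.2.1 (v i)) e.1.1 e.1.2 ↔ G.Adj e.1.1 e.1.2} := by
    ext q
    rw [evSet_iff hks hv]
    simp only [Set.mem_inter_iff, Set.mem_preimage, Set.mem_iInter, Set.mem_ofPred_eq]
  rw [this]
  refine ((measurableSet_goodSet d n r v).preimage measurable_fst).inter (MeasurableSet.iInter fun e => ?_)
  refine measurableSet_iff' (measurableSet_le (by fun_prop) ?_) (MeasurableSet.const _)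
  exact measurable_pmat hk (by fun_prop) (by fun_prop) _ _

/-- The data of the model. -/
def dataOf {d : ℕ} {Ω : Type} [MeasurableSpace Ω] (M : SIRGModel d Ω) (n : ℕ) (ω : Ω) :
    (Fin n → Euc d) × (Fin n → ℝ) × (Fin n → Fin n → ℝ) :=
  ((fun i => M.Y n i ω), (fun i => M.Wt n i ω), (fun i j => M.U n i j ω))

theorem measurable_dataOf {d : ℕ} {Ω : Type} [MeasurableSpace Ω] (M : SIRGModel d Ω) (n : ℕ) :
    Measurable (dataOf M n) := by
  have h1 := M.Y_meas n
  have h2 := M.Wt_meas n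
  have h3 := M.U_meas n
  unfold dataOf
  fun_prop

theorem ev_prob {d : ℕ} (hd : 1 ≤ d) {Ω : Type} [MeasurableSpace Ω] (M : SIRGModel d Ω) {n : ℕ} (hn : 1 ≤ n)
    {r : ℝ} (hr : 0 < r) {l : ℕ} (G : SimpleGraph (Fin (l + 1)))
    {v : Fin (l + 1) → Fin n} (hv : Function.Injective v) :
    M.P (dataOf M n ⁻¹' (evSet d n r (M.κn n) v G)) =
    (1 - lamB d r * (n : ℝ≥0∞)⁻¹) ^ (n - (l + 1)) * (unifBox d n (inBox d n r) *
      ((lamB d r * (n : ℝ≥0∞)⁻¹) ^ l *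
        ∫⁻ ω, ENNReal.ofReal (Psi d r G (M.κn n) (fun i => M.Wt n (v i) ω)) ∂M.P)) := by
  have := prob_unifBox d n hd hn
  have := prob_unifBall d r hr
  have hW := M.Wt_meas n
  have hY := M.Y_meas n
  have hU := M.U_meas n
  have hk := M.κn_meas n
  set k := M.κn n with hkdef
  let E := {p : Fin n × Fin n // p.1 < p.2}
  let μw : Measure (Fin n → ℝ) := Measure.map (fun ω i => M.Wt n i ω) M.P
  have hWm : Measurable (fun ω i => M.Wt n i ω) := by fun_prop
  have : IsProbabilityMeasure μw := Measure.isProbabilityMeasure_map hWm.aemeasurable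
  let S : Set ((Fin n → Euc d) × (Fin n → ℝ) × (E → ℝ)) :=
    {q | q.1 ∈ goodSet d n r v ∧ ∀ e : {e : Fin (l + 1) × Fin (l + 1) // e.1 < e.2},
      (q.2.2 (sortP v hv e) ≤ pmat k (fun i => q.1 (v i)) (fun i => q.2.1 (v i)) e.1.1 e.1.2 ↔ G.Adj e.1.1 e.1.2)}
  have hSm : MeasurableSet S := by
    have : S = Prod.fst ⁻¹' (goodSet d n r v) ∩
      ⋂ e : {e : Fin (l + 1) × Fin (l + 1) // e.1 < e.2}, {q | q.2.2 (sortP v hv e) ≤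
        pmat k (fun i => q.1 (v i)) (fun i => q.2.1 (v i)) e.1.1 e.1.2 ↔ G.Adj e.1.1 e.1.2} := by
      ext q
      simp only [S, Set.mem_inter_iff, Set.mem_preimage, Set.mem_iInter, Set.mem_ofPred_eq]
    rw [this]
    refine ((measurableSet_goodSet d n r v).preimage measurable_fst).inter (MeasurableSet.iInter fun e => ?_)
    refine measurableSet_iff' (measurableSet_le (by fun_prop) ?_) (MeasurableSet.const _)
    exact measurable_pmat hk (by fun_prop) (by fun_prop) _ _
  have e1 : dataOf M n ⁻¹' (evSet d n r k v G) = (fun ω =>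
        ((fun i => M.Y n i ω), (fun i => M.Wt n i ω),
          (fun p : E => M.U n p.1.1 p.1.2 ω))) ⁻¹' S := by
    ext ω
    rw [Set.mem_preimage, evSet_iff (M.κn_symm n) hv]
    rfl
  have hTm : Measurable (fun ω => ((fun i => M.Y n i ω), (fun i => M.Wt n i ω),
          (fun p : E => M.U n p.1.1 p.1.2 ω))) := by fun_prop
  rw [e1, ← Measure.map_apply hTm hSm, M.joint_law n, Measure.prod_apply hSm]
  let F : (Fin (l + 1) → Euc d) → ℝ≥0∞ := fun a =>
    ∫⁻ w, ENNReal.ofReal (phi G (pmat k a (fun i => w (v i)))) ∂μw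
  have hphim : Measurable (fun q : (Fin (l + 1) → Euc d) × (Fin n → ℝ) =>
      ENNReal.ofReal (phi G (pmat k q.1 (fun i => q.2 (v i))))) := by
    have h1 : Measurable (fun q : (Fin (l + 1) → Euc d) × (Fin n → ℝ) => (q.1, fun i => q.2 (v i))) := by
      fun_prop
    exact ((measurable_phi_pmat G hk).comp h1).ennreal_ofReal
  have hF : Measurable F := hphim.lintegral_prod_right'
  have e2 : ∀ y : Fin n → Euc d, (μw.prod (Measure.pi fun _ : E => unif01)) (Prod.mk y ⁻¹' S) =
      (goodSet d n r v).indicator (fun y => F (fun i => y (v i))) y := by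
    intro y
    by_cases hy : y ∈ goodSet d n r v
    · rw [Set.indicator_of_mem hy, Measure.prod_apply (hSm.preimage (by fun_prop))]
      refine lintegral_congr fun w => ?_
      rw [← phi_eq_pairs, ← (pi_comp_inj unif01 (sortP v hv) (sortP_inj v hv)).measure_preimage]
      · congr 1
        ext u
        simp only [S, Set.mem_preimage, Set.mem_ofPred_eq, hy, true_and]
      · refine MeasurableSet.nullMeasurableSet ?_
        simp only [Set.ofPred_forall]
        exact MeasurableSet.iInter fun e => measurableSet_iff'
          (measurableSet_le (by fun_prop) measurable_const) (MeasurableSet.const _)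
    · rw [Set.indicator_of_notMem hy]
      have : Prod.mk y ⁻¹' S = ∅ := by
        ext u; simp [S, hy]
      rw [this, measure_empty]
  have e2' := lintegral_congr (μ := Measure.pi fun _ : Fin n => unifBox d n) e2
  refine Eq.trans e2' ?_
  rw [lintegral_indicator (measurableSet_goodSet d n r v), geom_one hd hn hr v hv F hF,
    geom_two hd hn hr F hF]
  · congr 3
    rw [lintegral_lintegral_swap]
    · rw [lintegral_map (f := fun w => ∫⁻ z, ENNReal.ofReal (phi G (pmat k (withZero z) fun i => w (v i)))
        ∂(Measure.pi fun _ : Fin l => unifBall d r)) _ hWm]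
      · refine lintegral_congr fun ω => ?_
        rw [ofReal_Psi d hr G hk]
      · have h1 : Measurable (fun q : (Fin n → ℝ) × (Fin l → Euc d) => ((withZero q.2 : Fin (l + 1) → Euc d), q.1)) :=
          ((measurable_withZero d l).comp measurable_snd).prodMk measurable_fst
        exact (hphim.comp h1).lintegral_prod_right'
    · have h1 : Measurable (fun q : (Fin l → Euc d) × (Fin n → ℝ) => ((withZero q.1 : Fin (l + 1) → Euc d), q.2)) :=
        ((measurable_withZero d l).comp measurable_fst).prodMk measurable_snd
      exact (hphim.comp h1).aemeasurable
  · intro a c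
    have hp : ∀ w, pmat k (fun i => a i + c) w = pmat k a w := fun w => by
      funext i j
      simp [pmat]
    simp only [F, hp]

open Classical in
theorem count_v {n l : ℕ} (S : Set (Fin n)) (i : Fin n) (hi : i ∈ S) (hS : Fintype.card S = l + 1) :
    (Finset.univ.filter fun v : Fin (l + 1) → Fin n =>
      Function.Injective v ∧ v 0 = i ∧ Set.range v = S).card = Nat.factorial l := by
  let T := {x : S // x.1 ≠ i}
  have hT : Fintype.card T = l := by
    have h1 : Fintype.card {x : S // ¬ x = ⟨i, hi⟩} = l := by
      rw [Fintype.card_subtype_compl, Fintype.card_subtype_eq, hS]; rfl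
    rw [← h1]
    refine Fintype.card_congr (Equiv.subtypeEquivRight fun x => ?_)
    rw [Subtype.ext_iff]
  have h2 : Fintype.card (Fin l ↪ T) = Nat.factorial l := by
    rw [Fintype.card_embedding_eq, hT, Fintype.card_fin, Nat.descFactorial_self]
  rw [← h2, ← Finset.card_univ]
  symm
  refine Finset.card_bij (fun σ _ => (Fin.cons i fun a => (σ a).1.1 : Fin (l + 1) → Fin n)) ?_ ?_ ?_
  · intro σ _
    simp only [Finset.mem_filter, Finset.mem_univ, true_and, Fin.cons_zero]
    refine ⟨?_, ?_⟩
    · rw [Fin.cons_injective_iff]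
      refine ⟨?_, fun a b hab => σ.injective (Subtype.ext (Subtype.ext hab))⟩
      rintro ⟨a, ha⟩
      exact (σ a).2 ha
    · have hb : Function.Bijective σ :=
        (Fintype.bijective_iff_injective_and_card _).2 ⟨σ.injective, by rw [hT, Fintype.card_fin]⟩
      rw [Fin.range_cons]
      ext x
      constructor
      · rintro (rfl | ⟨a, rfl⟩)
        · exact hi
        · exact (σ a).1.2
      · intro hx
        by_cases hxi : x = i
        · exact Or.inl hxi
        · obtain ⟨a, ha⟩ := hb.2 ⟨⟨x, hx⟩, hxi⟩
          exact Or.inr ⟨a, by simp only [ha]⟩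
  · intro σ _ τ _ h
    have := (Fin.cons_injective2 h).2
    ext a
    have h3 := congrFun this a
    exact congrArg Fin.val h3
  · intro v hv
    simp only [Finset.mem_filter, Finset.mem_univ, true_and] at hv
    obtain ⟨hv1, hv2, hv3⟩ := hv
    refine ⟨⟨fun a => ⟨⟨v a.succ, hv3 ▸ Set.mem_range_self _⟩, ?_⟩, ?_⟩, Finset.mem_univ _, ?_⟩
    · rw [← hv2]
      exact fun h => Fin.succ_ne_zero a (hv1 h)
    · intro a b hab
      have h4 : v a.succ = v b.succ := congrArg (fun x : T => x.1.1) hab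
      exact Fin.succ_injective _ (hv1 h4)
    · funext a
      refine Fin.cases ?_ (fun a => ?_) a
      · simp [hv2]
      · rw [Fin.cons_succ]
        rfl

theorem iso_comap {n l : ℕ} (Γ : SimpleGraph (Fin n)) {v : Fin (l + 1) → Fin n} (hv : Function.Injective v)
    (S : Set (Fin n)) (hS : Set.range v = S) {V : Type} (H : SimpleGraph V) (h : V) (hi : v 0 ∈ S) :
    RootedIso (Γ.comap v) 0 H h ↔ RootedIso (Γ.induce S) ⟨v 0, hi⟩ H h := by
  subst hS
  let e : Γ.comap v ≃g Γ.induce (Set.range v) := ⟨Equiv.ofInjective v hv, Iff.rfl⟩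
  have he : e 0 = ⟨v 0, hi⟩ := rfl
  have he' : e.symm ⟨v 0, hi⟩ = 0 := by rw [← he]; exact e.symm_apply_apply 0
  constructor
  · rintro ⟨φ, hφ⟩
    exact ⟨e.symm.trans φ, by simp [RelIso.trans_apply, he', hφ]⟩
  · rintro ⟨φ, hφ⟩
    exact ⟨e.trans φ, by simp [RelIso.trans_apply, he, hφ]⟩

/-- The neighbourhood event in terms of the data, with root in the inner box. -/
def nbEv (d n : ℕ) (r : ℝ) (k : ℝ → ℝ → ℝ → ℝ) (i : Fin n) {V : Type} (H : SimpleGraph V) (h : V) :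
    Set ((Fin n → Euc d) × (Fin n → ℝ) × (Fin n → Fin n → ℝ)) :=
  {q | q.1 i ∈ inBox d n r ∧ ∃ hi : i ∈ {j | dist (q.1 j) (q.1 i) < r},
    RootedIso ((gOf (pmat k q.1 q.2.1) q.2.2).induce {j | dist (q.1 j) (q.1 i) < r}) ⟨i, hi⟩ H h}

open Classical in
theorem nb_count {d n : ℕ} {r : ℝ} (hr : 0 < r) {l : ℕ} (k : ℝ → ℝ → ℝ → ℝ) (i : Fin n)
    {V : Type} [Fintype V] (hV : Fintype.card V = l + 1) (H : SimpleGraph V) (h : V)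
    (q : (Fin n → Euc d) × (Fin n → ℝ) × (Fin n → Fin n → ℝ)) :
    ∑ G ∈ Finset.univ.filter (fun G : SimpleGraph (Fin (l + 1)) => RootedIso G 0 H h),
      ∑ v ∈ Finset.univ.filter (Function.Injective : (Fin (l + 1) → Fin n) → Prop),
        (if v 0 = i then (evSet d n r k v G).indicator (fun _ => (1 : ℝ≥0∞)) q else 0) =
    (Nat.factorial l : ℝ≥0∞) * (nbEv d n r k i H h).indicator 1 q := by
  set Γ := gOf (pmat k q.1 q.2.1) q.2.2 with hΓ
  set S : Set (Fin n) := {j | dist (q.1 j) (q.1 i) < r} with hSdef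
  have hiS : i ∈ S := by simp [S, hr]
  rw [Finset.sum_comm]
  have e1 : ∀ v : Fin (l + 1) → Fin n,
      ∑ G ∈ Finset.univ.filter (fun G : SimpleGraph (Fin (l + 1)) => RootedIso G 0 H h),
        (if v 0 = i then (evSet d n r k v G).indicator (fun _ => (1 : ℝ≥0∞)) q else 0) =
      if (v 0 = i ∧ q.1 ∈ goodSet d n r v ∧ RootedIso (Γ.comap v) 0 H h) then 1 else 0 := by
    intro v
    by_cases h0 : v 0 = i
    · simp only [h0, if_true, true_and, evSet, Set.indicator_apply, Set.mem_ofPred_eq, Pi.one_apply, ← hΓ]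
      by_cases hg : q.1 ∈ goodSet d n r v
      · simp only [hg, true_and, Finset.sum_ite_eq, Finset.mem_filter, Finset.mem_univ]
      · simp [hg]
    · simp [h0]
  rw [Finset.sum_congr rfl fun v _ => e1 v, ← Finset.sum_filter, Finset.sum_const, nsmul_one,
    Finset.filter_filter]
  have hgood : ∀ v : Fin (l + 1) → Fin n, v 0 = i →
      (q.1 ∈ goodSet d n r v ↔ q.1 i ∈ inBox d n r ∧ Set.range v = S) := by
    intro v h0
    simp only [goodSet, Set.mem_ofPred_eq, h0]
    refine and_congr Iff.rfl ⟨?_, ?_⟩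
    · rintro ⟨h1, h2⟩
      ext j
      constructor
      · rintro ⟨a, rfl⟩; exact h1 a
      · intro hj
        by_contra hc
        exact h2 j hc hj
    · intro hS
      refine ⟨fun a => ?_, fun j hj hc => hj (hS ▸ hc)⟩
      have : v a ∈ S := hS ▸ Set.mem_range_self a
      exact this
  by_cases hq : q ∈ nbEv d n r k i H h
  · rw [Set.indicator_of_mem hq, Pi.one_apply, mul_one]
    obtain ⟨hb, hi, hiso⟩ := hq
    have hiso' : RootedIso (Γ.induce S) ⟨i, hiS⟩ H h := hiso
    have hS : Fintype.card S = l + 1 := by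
      obtain ⟨φ, -⟩ := hiso'
      rw [← hV]; exact Fintype.card_congr φ.toEquiv
    rw [← count_v S i hiS hS]
    congr 2
    ext v
    simp only [Finset.mem_filter, Finset.mem_univ, true_and]
    refine and_congr_right fun hv => and_congr_right fun h0 => ?_
    rw [hgood v h0]
    constructor
    · rintro ⟨⟨-, h1⟩, -⟩; exact h1
    · intro h1
      refine ⟨⟨hb, h1⟩, ?_⟩
      subst h0
      exact (iso_comap Γ hv S h1 H h hiS).2 hiso'
  · rw [Set.indicator_of_notMem hq, mul_zero, Finset.filter_false_of_mem]
    · simp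
    · rintro v - ⟨hv, h0, h1, h2⟩
      rw [hgood v h0] at h1
      refine hq ⟨h1.1, hiS, ?_⟩
      subst h0
      exact (iso_comap Γ hv S h1.2 H h hiS).1 h2

open Classical in
theorem nbEv_eq {d n : ℕ} {r : ℝ} (hr : 0 < r) {l : ℕ} (k : ℝ → ℝ → ℝ → ℝ) (i : Fin n)
    {V : Type} [Fintype V] (hV : Fintype.card V = l + 1) (H : SimpleGraph V) (h : V) :
    nbEv d n r k i H h =
      ⋃ G ∈ Finset.univ.filter (fun G : SimpleGraph (Fin (l + 1)) => RootedIso G 0 H h),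
      ⋃ v ∈ Finset.univ.filter (fun v : Fin (l + 1) → Fin n => Function.Injective v ∧ v 0 = i),
        evSet d n r k v G := by
  ext q
  have key := nb_count hr k i hV H h q
  have hl : (Nat.factorial l : ℝ≥0∞) ≠ 0 := by exact_mod_cast Nat.factorial_ne_zero l
  have h1 : q ∉ nbEv d n r k i H h ↔
      ∑ G ∈ Finset.univ.filter (fun G : SimpleGraph (Fin (l + 1)) => RootedIso G 0 H h),
      ∑ v ∈ Finset.univ.filter (Function.Injective : (Fin (l + 1) → Fin n) → Prop),
        (if v 0 = i then (evSet d n r k v G).indicator (fun _ => (1 : ℝ≥0∞)) q else 0) = 0 := by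
    rw [key, mul_eq_zero]
    simp [hl, Nat.factorial_ne_zero]
  rw [← not_iff_not, h1, Finset.sum_eq_zero_iff]
  simp only [Finset.sum_eq_zero_iff, Set.mem_iUnion, not_exists, Finset.mem_filter, Finset.mem_univ,
    true_and, ite_eq_right_iff, Set.indicator_apply_eq_zero, Pi.one_apply, one_ne_zero, imp_false, and_imp]

theorem measurableSet_nbEv {d n : ℕ} {r : ℝ} (hr : 0 < r) {k : ℝ → ℝ → ℝ → ℝ}
    (hks : ∀ t x y, k t x y = k t y x) (hk : Measurable fun p : ℝ × ℝ × ℝ => k p.1 p.2.1 p.2.2)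
    (i : Fin n) {V : Type} [Fintype V] (H : SimpleGraph V) (h : V) :
    MeasurableSet (nbEv d n r k i H h) := by
  classical
  obtain ⟨l, hV⟩ : ∃ l, Fintype.card V = l + 1 :=
    have : Nonempty V := ⟨h⟩
    Nat.exists_eq_succ_of_ne_zero Fintype.card_ne_zero
  rw [nbEv_eq hr k i hV H h]
  refine Finset.measurableSet_biUnion _ fun G _ => Finset.measurableSet_biUnion _ fun v hv => ?_
  simp only [Finset.mem_filter, Finset.mem_univ, true_and] at hv
  exact measurableSet_evSet hks hk hv.1 G

open Classical in
theorem nb_sum {d : ℕ} {Ω : Type} [MeasurableSpace Ω] (M : SIRGModel d Ω) {n : ℕ}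
    {r : ℝ} (hr : 0 < r) {l : ℕ} {V : Type} [Fintype V] (hV : Fintype.card V = l + 1)
    (H : SimpleGraph V) (h : V) :
    (Nat.factorial l : ℝ≥0∞) * ∑ i : Fin n, M.P (dataOf M n ⁻¹' nbEv d n r (M.κn n) i H h) =
    ∑ G ∈ Finset.univ.filter (fun G : SimpleGraph (Fin (l + 1)) => RootedIso G 0 H h),
      ∑ v ∈ Finset.univ.filter (Function.Injective : (Fin (l + 1) → Fin n) → Prop),
        M.P (dataOf M n ⁻¹' (evSet d n r (M.κn n) v G)) := by
  have hD := measurable_dataOf M n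
  have key : ∀ i : Fin n, (Nat.factorial l : ℝ≥0∞) * M.P (dataOf M n ⁻¹' nbEv d n r (M.κn n) i H h) =
      ∑ G ∈ Finset.univ.filter (fun G : SimpleGraph (Fin (l + 1)) => RootedIso G 0 H h),
      ∑ v ∈ Finset.univ.filter (Function.Injective : (Fin (l + 1) → Fin n) → Prop),
        if v 0 = i then M.P (dataOf M n ⁻¹' (evSet d n r (M.κn n) v G)) else 0 := by
    intro i
    have hm := measurableSet_nbEv hr (M.κn_symm n) (M.κn_meas n) i H h (d := d)
    have h1 : ∫⁻ ω, (Nat.factorial l : ℝ≥0∞) * (nbEv d n r (M.κn n) i H h).indicator 1 (dataOf M n ω) ∂M.P =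
        (Nat.factorial l : ℝ≥0∞) * M.P (dataOf M n ⁻¹' nbEv d n r (M.κn n) i H h) := by
      rw [lintegral_const_mul' _ _ (by finiteness)]
      congr 1
      rw [← lintegral_indicator_one (hm.preimage hD)]
      rfl
    rw [← h1, ← lintegral_congr fun ω => nb_count hr (M.κn n) i hV H h (dataOf M n ω)]
    have hmv : ∀ (G : SimpleGraph (Fin (l + 1))) (v : Fin (l + 1) → Fin n),
        v ∈ Finset.univ.filter (Function.Injective : (Fin (l + 1) → Fin n) → Prop) →
        Measurable (fun ω => if v 0 = i then (evSet d n r (M.κn n) v G).indicator (fun _ => (1 : ℝ≥0∞)) (dataOf M n ω) else 0) := by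
      intro G v hv
      simp only [Finset.mem_filter, Finset.mem_univ, true_and] at hv
      by_cases h0 : v 0 = i
      · simp only [h0, if_true]
        exact (measurable_const.indicator (measurableSet_evSet (M.κn_symm n) (M.κn_meas n) hv G)).comp hD
      · simp only [h0, if_false]
        exact measurable_const
    rw [lintegral_finsetSum _ fun G _ => Finset.measurable_sum _ fun v hv => hmv G v hv]
    refine Finset.sum_congr rfl fun G _ => ?_
    rw [lintegral_finsetSum' _ fun v hv => (hmv G v hv).aemeasurable]
    refine Finset.sum_congr rfl fun v hv => ?_
    simp only [Finset.mem_filter, Finset.mem_univ, true_and] at hv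
    by_cases h0 : v 0 = i
    · simp only [h0, if_true]
      rw [← lintegral_indicator_one ((measurableSet_evSet (M.κn_symm n) (M.κn_meas n) hv G).preimage hD)]
      rfl
    · simp [h0]
  rw [Finset.mul_sum, Finset.sum_congr rfl fun i _ => key i, Finset.sum_comm]
  refine Finset.sum_congr rfl fun G _ => ?_
  rw [Finset.sum_comm]
  refine Finset.sum_congr rfl fun v _ => ?_
  simp

theorem root_prob {d : ℕ} {Ω : Type} [MeasurableSpace Ω] (M : SIRGModel d Ω) {n : ℕ} (hn : 0 < n)
    (B : Fin n → Set ((Fin n → Euc d) × (Fin n → ℝ) × (Fin n → Fin n → ℝ)))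
    (hB : ∀ i, MeasurableSet (B i)) :
    M.P {ω | dataOf M n ω ∈ B (M.R n hn 0 ω)} = (n : ℝ≥0∞)⁻¹ * ∑ i, M.P (dataOf M n ⁻¹' B i) := by
  have hD := measurable_dataOf M n
  have hR : ∀ i, MeasurableSet {ω | M.R n hn 0 ω = i} := fun i =>
    (measurableSet_singleton i).preimage (M.R_meas n hn 0)
  have hR1 : ∀ i, MeasurableSet {ω | M.R n hn 1 ω = i} := fun i =>
    (measurableSet_singleton i).preimage (M.R_meas n hn 1)
  have hn0 : (n : ℝ≥0∞) ≠ 0 := by exact_mod_cast hn.ne'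
  have hp : ∀ i, M.P {ω | M.R n hn 0 ω = i} = (n : ℝ≥0∞)⁻¹ := by
    intro i
    have e : {ω | M.R n hn 0 ω = i} = ⋃ j, {ω | M.R n hn 0 ω = i ∧ M.R n hn 1 ω = j} := by
      ext ω; simp
    rw [e, measure_iUnion, tsum_fintype]
    · simp only [M.R_unif n hn i, Finset.sum_const, Finset.card_univ, Fintype.card_fin, nsmul_eq_mul]
      rw [ENNReal.mul_inv (Or.inl hn0) (Or.inl (by finiteness)), ← mul_assoc,
        ENNReal.mul_inv_cancel hn0 (by finiteness), one_mul]
    · intro a b hab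
      rw [Function.onFun, Set.disjoint_left]
      rintro ω ⟨-, h1⟩ ⟨-, h2⟩
      exact hab (h1.symm.trans h2)
    · exact fun j => (hR i).inter (hR1 j)
  have e : {ω | dataOf M n ω ∈ B (M.R n hn 0 ω)} = ⋃ i, ({ω | M.R n hn 0 ω = i} ∩ dataOf M n ⁻¹' B i) := by
    ext ω; simp
  rw [e, measure_iUnion, tsum_fintype, Finset.mul_sum]
  · refine Finset.sum_congr rfl fun i _ => ?_
    have := (M.R_indep n hn).measure_inter_preimage_eq_mul _ _
      ((measurableSet_singleton i).preimage measurable_fst) (hB i)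
    rw [← hp i]
    exact this
  · intro a b hab
    rw [Function.onFun, Set.disjoint_left]
    rintro ω ⟨h1, -⟩ ⟨h2, -⟩
    exact hab (Eq.symm h1 |>.trans h2)
  · exact fun i => (hR i).inter ((hB i).preimage hD)

theorem Y_marg {d : ℕ} (hd : 1 ≤ d) {Ω : Type} [MeasurableSpace Ω] (M : SIRGModel d Ω) {n : ℕ} (hn : 1 ≤ n)
    (i : Fin n) {C : Set (Euc d)} (hC : MeasurableSet C) :
    M.P (dataOf M n ⁻¹' {q | q.1 i ∈ C}) = unifBox d n C := by
  have := prob_unifBox d n hd hn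
  have h1 := M.Y_meas n
  have h2 := M.Wt_meas n
  have h3 := M.U_meas n
  have hTm : Measurable (fun ω => ((fun i => M.Y n i ω), (fun i => M.Wt n i ω),
          (fun p : {p : Fin n × Fin n // p.1 < p.2} => M.U n p.1.1 p.1.2 ω))) := by fun_prop
  have hWm : Measurable (fun ω i => M.Wt n i ω) := by fun_prop
  have : IsProbabilityMeasure (Measure.map (fun ω i => M.Wt n i ω) M.P) :=
    Measure.isProbabilityMeasure_map hWm.aemeasurable
  have hS : MeasurableSet (((fun y : Fin n → Euc d => y i) ⁻¹' C) ×ˢ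
      (Set.univ : Set ((Fin n → ℝ) × ({p : Fin n × Fin n // p.1 < p.2} → ℝ)))) :=
    (hC.preimage (by fun_prop)).prod MeasurableSet.univ
  have e : dataOf M n ⁻¹' {q | q.1 i ∈ C} = (fun ω => ((fun i => M.Y n i ω), (fun i => M.Wt n i ω),
          (fun p : {p : Fin n × Fin n // p.1 < p.2} => M.U n p.1.1 p.1.2 ω))) ⁻¹'
          (((fun y : Fin n → Euc d => y i) ⁻¹' C) ×ˢ Set.univ) := by
    ext ω; simp [dataOf]
  rw [e, ← Measure.map_apply hTm hS, M.joint_law n, Measure.prod_prod, measure_univ, mul_one]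
  exact (measurePreserving_eval (fun _ : Fin n => unifBox d n) i).measure_preimage hC.nullMeasurableSet

theorem inBox_tendsto {d : ℕ} (hd : 1 ≤ d) (r : ℝ) (hr : 0 < r) :
    Tendsto (fun n : ℕ => unifBox d (n + 1) (inBox d (n + 1) r)) atTop (𝓝 1) := by
  have hd0 : (d : ℝ) ≠ 0 := by positivity
  have hlim : Tendsto (fun n : ℕ => (((n + 1 : ℕ) : ℝ) ^ ((1 : ℝ) / d))) atTop atTop :=
    (tendsto_rpow_atTop (by positivity)).comp
      (tendsto_natCast_atTop_atTop.comp (tendsto_add_atTop_nat 1))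
  have h1 : Tendsto (fun n : ℕ => ENNReal.ofReal ((1 - 2 * r / (((n + 1 : ℕ) : ℝ) ^ ((1 : ℝ) / d))) ^ d)) atTop (𝓝 1) := by
    have : Tendsto (fun n : ℕ => ((1 - 2 * r / (((n + 1 : ℕ) : ℝ) ^ ((1 : ℝ) / d))) ^ d)) atTop (𝓝 ((1 - 0) ^ d)) :=
      (tendsto_const_nhds.sub (hlim.const_div_atTop _)).pow d
    have h2 := ENNReal.tendsto_ofReal this
    simpa using h2
  refine h1.congr' ?_
  filter_upwards [hlim.eventually_ge_atTop (2 * r)] with n hn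
  set x := (((n + 1 : ℕ) : ℝ) ^ ((1 : ℝ) / d)) with hx
  have hx0 : 0 < x := by positivity
  have hxd : x ^ d = ((n + 1 : ℕ) : ℝ) := by
    rw [hx, ← Real.rpow_natCast, ← Real.rpow_mul (by positivity), one_div_mul_cancel hd0, Real.rpow_one]
  have hsub : inBox d (n + 1) r ∩ boxIn d (n + 1) = inBox d (n + 1) r := by
    refine Set.inter_eq_left.2 fun y hy i => (hy i).trans ?_
    linarith
  rw [unifBox, Measure.smul_apply, Measure.restrict_apply (measurableSet_inBox _ _ _), hsub, smul_eq_mul]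
  have hv : volume (inBox d (n + 1) r) = ENNReal.ofReal (2 * (x / 2 - r)) ^ d :=
    volume_cube d _ (by linarith)
  have hN : ((n + 1 : ℕ) : ℝ≥0∞) = ENNReal.ofReal (((n + 1 : ℕ) : ℝ)) := by
    rw [ENNReal.ofReal_natCast]
  rw [hv, hN, ← ENNReal.ofReal_inv_of_pos (by positivity), ← ENNReal.ofReal_pow (by linarith),
    ← ENNReal.ofReal_mul (by positivity), ← hxd]
  congr 1
  rw [← inv_pow, ← mul_pow]
  congr 1
  field_simp

theorem pois_tendsto {lam : ℝ≥0∞} (hlam : lam ≠ ∞) (l : ℕ) :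
    Tendsto (fun n : ℕ => (1 - lam * ((n + 1 : ℕ) : ℝ≥0∞)⁻¹) ^ (n + 1 - (l + 1))) atTop
      (𝓝 (ENNReal.ofReal (Real.exp (-lam.toReal)))) := by
  set a := lam.toReal with ha
  have hN : Tendsto (fun n : ℕ => ((n + 1 : ℕ) : ℝ)) atTop atTop :=
    tendsto_natCast_atTop_atTop.comp (tendsto_add_atTop_nat 1)
  have h1 : Tendsto (fun n : ℕ => (1 + (-a) / ((n + 1 : ℕ) : ℝ)) ^ (n + 1)) atTop (𝓝 (Real.exp (-a))) :=
    (Real.tendsto_one_add_div_pow_exp (-a)).comp (tendsto_add_atTop_nat 1)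
  have h2 : Tendsto (fun n : ℕ => (1 + (-a) / ((n + 1 : ℕ) : ℝ)) ^ (l + 1)) atTop (𝓝 ((1 + 0) ^ (l + 1))) :=
    (tendsto_const_nhds.add (hN.const_div_atTop _)).pow _
  have h3 := ENNReal.tendsto_ofReal (h1.div h2 (by simp))
  rw [add_zero, one_pow, div_one] at h3
  refine h3.congr' ?_
  filter_upwards [hN.eventually_gt_atTop a, eventually_ge_atTop l] with n hn hl
  have hpos : (0 : ℝ) < ((n + 1 : ℕ) : ℝ) := by positivity
  have hlt : a / ((n + 1 : ℕ) : ℝ) < 1 := (div_lt_one hpos).2 hn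
  have e : 1 - lam * ((n + 1 : ℕ) : ℝ≥0∞)⁻¹ = ENNReal.ofReal (1 + (-a) / ((n + 1 : ℕ) : ℝ)) := by
    have : lam * ((n + 1 : ℕ) : ℝ≥0∞)⁻¹ = ENNReal.ofReal (a / ((n + 1 : ℕ) : ℝ)) := by
      rw [ENNReal.ofReal_div_of_pos hpos, ENNReal.ofReal_natCast, ha, ENNReal.ofReal_toReal hlam]
      rfl
    rw [this, ← ENNReal.ofReal_one, ← ENNReal.ofReal_sub _ (by positivity)]
    congr 1; ring
  have hne : (1 + (-a) / ((n + 1 : ℕ) : ℝ)) ≠ 0 := by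
    have : 0 < 1 + (-a) / ((n + 1 : ℕ) : ℝ) := by rw [neg_div]; linarith
    exact this.ne'
  rw [e, ← ENNReal.ofReal_pow (by rw [neg_div]; linarith), pow_sub₀ _ hne (by omega), Pi.div_apply, div_eq_mul_inv]

open Classical in
theorem limit_term {d : ℕ} {r : ℝ} (hr : 0 < r) {k : ℝ → ℝ → ℝ → ℝ}
    (hk : Measurable fun p : ℝ × ℝ × ℝ => k p.1 p.2.1 p.2.2) (μW : Measure ℝ) [IsProbabilityMeasure μW]
    {l : ℕ} {V : Type} (H : SimpleGraph V) (h : V) :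
    ((Measure.pi fun _ : Fin l => unifBall d r).prod
          ((Measure.pi fun _ : Fin (l + 1) => μW).prod
            (Measure.pi fun _ : Fin (l + 1) => Measure.pi fun _ : Fin (l + 1) => unif01)))
        {zwu : (Fin l → Euc d) × (Fin (l + 1) → ℝ) × (Fin (l + 1) → Fin (l + 1) → ℝ) |
          RootedIso (limitGraph d k l zwu.1 zwu.2.1 zwu.2.2) 0 H h} =
    ∑ G ∈ Finset.univ.filter (fun G : SimpleGraph (Fin (l + 1)) => RootedIso G 0 H h),
      ∫⁻ w, ENNReal.ofReal (Psi d r G k w) ∂(Measure.pi fun _ : Fin (l + 1) => μW) := by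
  have := prob_unifBall d r hr
  let B : SimpleGraph (Fin (l + 1)) → Set ((Fin l → Euc d) × (Fin (l + 1) → ℝ) × (Fin (l + 1) → Fin (l + 1) → ℝ)) :=
    fun G => {q | gOf (pmat k (withZero q.1) q.2.1) q.2.2 = G}
  have hB : ∀ G, MeasurableSet (B G) := by
    intro G
    have : B G = ⋂ e : {e : Fin (l + 1) × Fin (l + 1) // e.1 < e.2},
        {q | q.2.2 e.1.1 e.1.2 ≤ pmat k (withZero q.1) q.2.1 e.1.1 e.1.2 ↔ G.Adj e.1.1 e.1.2} := by
      ext q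
      simp only [B, Set.mem_ofPred_eq, Set.mem_iInter]
      rw [graph_eq_iff]
      refine forall_congr' fun e => ?_
      rw [gOf_adj_lt _ _ e.2]
    rw [this]
    refine MeasurableSet.iInter fun e => measurableSet_iff' (measurableSet_le (by fun_prop) ?_) (MeasurableSet.const _)
    exact measurable_pmat hk ((measurable_withZero d l).comp measurable_fst) (by fun_prop) _ _
  have e1 : {zwu : (Fin l → Euc d) × (Fin (l + 1) → ℝ) × (Fin (l + 1) → Fin (l + 1) → ℝ) |
          RootedIso (limitGraph d k l zwu.1 zwu.2.1 zwu.2.2) 0 H h} =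
      ⋃ G ∈ Finset.univ.filter (fun G : SimpleGraph (Fin (l + 1)) => RootedIso G 0 H h), B G := by
    ext q
    have : limitGraph d k l q.1 q.2.1 q.2.2 = gOf (pmat k (withZero q.1) q.2.1) q.2.2 := rfl
    simp [B, this]
  rw [e1, measure_biUnion_finset]
  · refine Finset.sum_congr rfl fun G _ => ?_
    rw [Measure.prod_apply (hB G)]
    have hm : Measurable (fun q : (Fin l → Euc d) × (Fin (l + 1) → ℝ) =>
        ENNReal.ofReal (phi G (pmat k (withZero q.1) q.2))) := by
      have h1 : Measurable (fun q : (Fin l → Euc d) × (Fin (l + 1) → ℝ) => ((withZero q.1 : Fin (l + 1) → Euc d), q.2)) :=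
        ((measurable_withZero d l).comp measurable_fst).prodMk measurable_snd
      exact ((measurable_phi_pmat G hk).comp h1).ennreal_ofReal
    have e2 : ∀ z : Fin l → Euc d, ((Measure.pi fun _ : Fin (l + 1) => μW).prod
            (Measure.pi fun _ : Fin (l + 1) => Measure.pi fun _ : Fin (l + 1) => unif01)) (Prod.mk z ⁻¹' B G) =
        ∫⁻ w, ENNReal.ofReal (phi G (pmat k (withZero z) w)) ∂(Measure.pi fun _ : Fin (l + 1) => μW) := by
      intro z
      rw [Measure.prod_apply ((hB G).preimage (by fun_prop))]
      refine lintegral_congr fun w => ?_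
      rw [← phi_eq_full]
      rfl
    rw [lintegral_congr e2, lintegral_lintegral_swap hm.aemeasurable]
    refine lintegral_congr fun w => ?_
    rw [ofReal_Psi d hr G hk]
  · intro G _ G' _ hne
    rw [Function.onFun, Set.disjoint_left]
    intro q hq hq'
    exact hne (Eq.symm hq |>.trans hq')
  · exact fun G _ => hB G

open Classical in
theorem limit_eq {d : ℕ} {r : ℝ} (hr : 0 < r) {k : ℝ → ℝ → ℝ → ℝ}
    (hk : Measurable fun p : ℝ × ℝ × ℝ => k p.1 p.2.1 p.2.2) (μW : Measure ℝ) [IsProbabilityMeasure μW]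
    {l : ℕ} {V : Type} [Fintype V] (hV : Fintype.card V = l + 1) (H : SimpleGraph V) (h : V) :
    limitNbhdProb d k μW r H h =
    ∑ G ∈ Finset.univ.filter (fun G : SimpleGraph (Fin (l + 1)) => RootedIso G 0 H h),
      ENNReal.ofReal (Real.exp (-(lamB d r).toReal)) * 1 * (lamB d r ^ l * (Nat.factorial l : ℝ≥0∞)⁻¹) *
      ∫⁻ w, ENNReal.ofReal (Psi d r G k w) ∂(Measure.pi fun _ : Fin (l + 1) => μW) := by
  rw [limitNbhdProb, tsum_eq_single l, limit_term hr hk μW H h, ← Finset.mul_sum]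
  · congr 1
    rw [poissonWeight, mul_div_assoc, ENNReal.ofReal_mul (by positivity), mul_one]
    congr 1
    rw [ENNReal.ofReal_div_of_pos (by positivity), ENNReal.ofReal_natCast, ENNReal.ofReal_pow (by positivity),
      ENNReal.ofReal_toReal (vol_ball_ne_top d r)]
    rfl
  · intro m hm
    have : {zwu : (Fin m → Euc d) × (Fin (m + 1) → ℝ) × (Fin (m + 1) → Fin (m + 1) → ℝ) |
          RootedIso (limitGraph d k m zwu.1 zwu.2.1 zwu.2.2) 0 H h} = ∅ := by
      ext q
      simp only [Set.mem_ofPred_eq, Set.mem_empty_iff_false, iff_false]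
      rintro ⟨φ, -⟩
      have := Fintype.card_congr φ.toEquiv
      rw [hV, Fintype.card_fin] at this
      omega
    rw [this, measure_empty, mul_zero]

open Classical in
theorem nb_root_tendsto {d : ℕ} (hd : 1 ≤ d) {Ω : Type} [MeasurableSpace Ω]
    (M : SIRGModel d Ω) (A : SIRGAssumptions M)
    {r : ℝ} (hr : 0 < r) {V : Type} [Fintype V] (H : SimpleGraph V) (h : V) :
    Tendsto (fun n : ℕ => M.P {ω | dataOf M (n + 1) ω ∈
        nbEv d (n + 1) r (M.κn (n + 1)) (M.R (n + 1) n.succ_pos 0 ω) H h})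
      atTop (𝓝 (limitNbhdProb d A.κ A.μW r H h)) := by
  obtain ⟨l, hV⟩ : ∃ l, Fintype.card V = l + 1 :=
    have : Nonempty V := ⟨h⟩
    Nat.exists_eq_succ_of_ne_zero Fintype.card_ne_zero
  have := A.probμW
  have hl0 : (Nat.factorial l : ℝ≥0∞) ≠ 0 := by exact_mod_cast Nat.factorial_ne_zero l
  have hlt : (Nat.factorial l : ℝ≥0∞) ≠ ∞ := by finiteness
  have hlam : lamB d r ≠ ∞ := vol_ball_ne_top d r
  rw [limit_eq hr A.κ_meas A.μW hV H h]
  have key : ∀ n : ℕ, M.P {ω | dataOf M (n + 1) ω ∈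
        nbEv d (n + 1) r (M.κn (n + 1)) (M.R (n + 1) n.succ_pos 0 ω) H h} =
      ∑ G ∈ Finset.univ.filter (fun G : SimpleGraph (Fin (l + 1)) => RootedIso G 0 H h),
        (1 - lamB d r * ((n + 1 : ℕ) : ℝ≥0∞)⁻¹) ^ (n + 1 - (l + 1)) * unifBox d (n + 1) (inBox d (n + 1) r) *
        (lamB d r ^ l * (Nat.factorial l : ℝ≥0∞)⁻¹) *
        ((((n + 1 : ℕ) : ℝ≥0∞) ^ (l + 1))⁻¹ *
      ∑ v ∈ Finset.univ.filter (Function.Injective : (Fin (l + 1) → Fin (n + 1)) → Prop),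
        ∫⁻ ω, ENNReal.ofReal (Psi d r G (M.κn (n + 1)) (fun i => M.Wt (n + 1) (v i) ω)) ∂M.P) := by
    intro n
    have h1 := nb_sum M (n := n + 1) hr hV H h
    rw [root_prob M n.succ_pos _ fun i => measurableSet_nbEv hr (M.κn_symm _) (M.κn_meas _) i H h]
    have h2 : ∑ i : Fin (n + 1), M.P (dataOf M (n + 1) ⁻¹' nbEv d (n + 1) r (M.κn (n + 1)) i H h) =
        (Nat.factorial l : ℝ≥0∞)⁻¹ * ∑ G ∈ Finset.univ.filter (fun G : SimpleGraph (Fin (l + 1)) => RootedIso G 0 H h),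
      ∑ v ∈ Finset.univ.filter (Function.Injective : (Fin (l + 1) → Fin (n + 1)) → Prop),
        M.P (dataOf M (n + 1) ⁻¹' (evSet d (n + 1) r (M.κn (n + 1)) v G)) := by
      rw [← h1, ← mul_assoc, ENNReal.inv_mul_cancel hl0 hlt, one_mul]
    rw [h2, Finset.mul_sum, Finset.mul_sum]
    refine Finset.sum_congr rfl fun G _ => ?_
    rw [Finset.sum_congr rfl fun v hv => ev_prob hd M (Nat.succ_le_succ (Nat.zero_le n)) hr G
      (Finset.mem_filter.1 hv).2]
    simp only [← Finset.mul_sum]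
    rw [mul_pow, ENNReal.inv_pow, pow_succ (((n + 1 : ℕ) : ℝ≥0∞)⁻¹) l]
    ring
  simp only [key]
  refine tendsto_finsetSum _ fun G _ => ?_
  have hT := T_conv hd M A hr G
  have hI : ∫⁻ w, ENNReal.ofReal (Psi d r G A.κ w) ∂(Measure.pi fun _ : Fin (l + 1) => A.μW) ≠ ∞ := by
    refine ne_top_of_le_ne_top (b := 1) (by finiteness) ?_
    calc _ ≤ ∫⁻ w, 1 ∂(Measure.pi fun _ : Fin (l + 1) => A.μW) :=
          lintegral_mono fun w => ENNReal.ofReal_le_one.2 (Psi_le_one d hr G A.κ_meas w)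
      _ = 1 := by simp
  have hc : lamB d r ^ l * (Nat.factorial l : ℝ≥0∞)⁻¹ ≠ ∞ :=
    ENNReal.mul_ne_top (ENNReal.pow_ne_top hlam) (ENNReal.inv_ne_top.2 hl0)
  have hP := pois_tendsto hlam l
  have hX := inBox_tendsto hd r hr
  have h1 := ENNReal.Tendsto.mul hP (Or.inr (by finiteness)) hX (Or.inr (by finiteness))
  have h2 := ENNReal.Tendsto.mul_const h1 (Or.inr hc)
  exact ENNReal.Tendsto.mul h2 (Or.inr hI) hT (Or.inr (by finiteness))

/-- Proposition: local convergence of Euclidean graph neighbourhoods.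
Under Assumptions (A1)–(A3), for every `r > 0` and every finite rooted graph `(H, h)`,
`P(F^{𝔾_n}_{U_n}(r) ≅ (H,h)) → P(F_r ≅ (H,h))` as `n → ∞`, where `U_n` is a uniformly
chosen vertex of `𝔾_n` and `F_r` is the Poissonized limiting `r`-neighbourhood. -/
theorem stmt1 {d : ℕ} (hd : 1 ≤ d) {Ω : Type} [MeasurableSpace Ω]
    (M : SIRGModel d Ω) (A : SIRGAssumptions M)
    (r : ℝ) (hr : 0 < r) {V : Type} [Fintype V] (H : SimpleGraph V) (h : V) :
    Tendsto (fun n : ℕ =>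
        M.P {ω | M.euclNbhdIso (n + 1) ω (M.R (n + 1) n.succ_pos 0 ω) r H h})
      atTop (𝓝 (limitNbhdProb d A.κ A.μW r H h)) := by
  have hmain := nb_root_tendsto hd M A hr H h
  have hout : Tendsto (fun n : ℕ => unifBox d (n + 1) (inBox d (n + 1) r)ᶜ) atTop (𝓝 0) := by
    have h1 := ENNReal.Tendsto.sub (tendsto_const_nhds (x := (1 : ℝ≥0∞))) (inBox_tendsto hd r hr)
      (Or.inl (by finiteness))
    rw [tsub_self] at h1
    refine h1.congr fun n => ?_
    have := prob_unifBox d (n + 1) hd (by omega)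
    rw [prob_compl_eq_one_sub (measurableSet_inBox _ _ _)]
  have hsum := hmain.add hout
  rw [add_zero] at hsum
  refine tendsto_of_tendsto_of_tendsto_of_le_of_le hmain hsum (fun n => ?_) (fun n => ?_)
  · refine measure_mono ?_
    rintro ω ⟨-, hi, hiso⟩
    exact ⟨hi, hiso⟩
  · have hY : M.P {ω | dataOf M (n + 1) ω ∈ (fun i : Fin (n + 1) =>
          {q : (Fin (n + 1) → Euc d) × (Fin (n + 1) → ℝ) × (Fin (n + 1) → Fin (n + 1) → ℝ) |
            q.1 i ∈ (inBox d (n + 1) r)ᶜ}) (M.R (n + 1) n.succ_pos 0 ω)} =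
        unifBox d (n + 1) (inBox d (n + 1) r)ᶜ := by
      have hm := (measurableSet_inBox d (n + 1) r).compl
      have hmq : ∀ i : Fin (n + 1), MeasurableSet
          {q : (Fin (n + 1) → Euc d) × (Fin (n + 1) → ℝ) × (Fin (n + 1) → Fin (n + 1) → ℝ) |
            q.1 i ∈ (inBox d (n + 1) r)ᶜ} := fun i => by
        have hev : Measurable (fun q : (Fin (n + 1) → Euc d) × (Fin (n + 1) → ℝ) ×
          (Fin (n + 1) → Fin (n + 1) → ℝ) => q.1 i) := by fun_prop
        exact hm.preimage hev
      refine (root_prob M n.succ_pos _ hmq).trans ?_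
      rw [Finset.sum_congr rfl fun i _ => Y_marg hd M (by omega) i hm]
      simp only [Finset.sum_const, Finset.card_univ, Fintype.card_fin, nsmul_eq_mul]
      rw [← mul_assoc, ENNReal.inv_mul_cancel (by simp) (by finiteness), one_mul]
    refine le_trans (measure_mono ?_) ((measure_union_le _ _).trans (add_le_add le_rfl hY.le))
    rintro ω ⟨hi, hiso⟩
    by_cases hb : M.Y (n + 1) (M.R (n + 1) n.succ_pos 0 ω) ω ∈ inBox d (n + 1) r
    · exact Or.inl ⟨hb, hi, hiso⟩
    · exact Or.inr hb


end
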